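/- arXiv:2505.19013 — 9 statements merged into one kernel-verified Lean document; each statement's English description precedes it below -/
import Mathlib

section
/- Let Ū : ℕ → ℝ satisfy the prudence condition, and let t_0, …, t_K (K ≥ 1) be positive integers (group sizes). Fix an index k ∈ {0,…,K} and a split t_k = a + b with integers a, b ≥ 1. Let EGSV_before be the expected Group Shapley Value of group k computed from the K+1 groups of sizes (t_0,…,t_K), and let EGSV_a and EGSV_b be the expected Group Shapley Values of the two subgroups of sizes a and b computed from the K+2 groups obtained by replacing the group of size t_k with two groups of sizes a and b. Then EGSV_before < EGSV_a + EGSV_b. -/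
/-- The expected Group Shapley Value of group `k` among `n` groups with sizes `t`,
computed from the expected utility function `Ubar`. -/
noncomputable def EGSV (Ubar : ℕ → ℝ) {n : ℕ} (t : Fin n → ℕ) (k : Fin n) : ℝ :=
  ∑ I ∈ (Finset.univ.erase k).powerset,
    ((Nat.factorial I.card * Nat.factorial (n - 1 - I.card) : ℕ) : ℝ) /
        ((Nat.factorial n : ℕ) : ℝ) *
      (Ubar ((∑ l ∈ I, t l) + t k) - Ubar (∑ l ∈ I, t l))

/-- A function with increasing first differences has increasing differences of any
positive step. -/
theorem strictMono_step_diff {f : ℕ → ℝ} (hf : StrictMono fun s => f (s + 1) - f s)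
    {a : ℕ} (ha : 1 ≤ a) : StrictMono fun s => f (s + a) - f s := by
  induction a, ha using Nat.le_induction with
  | base => exact hf
  | succ a ha ih =>
    intro x y hxy
    have h₁ := ih hxy
    have h₂ := hf (Nat.add_lt_add_right hxy a)
    simp only [← add_assoc] at h₁ h₂ ⊢
    linarith

/-- Under the prudence condition, mixed second differences are increasing. -/
theorem strictMono_mixed_diff {U : ℕ → ℝ}
    (hprud : ∀ s : ℕ, U (s + 3) - 3 * U (s + 2) + 3 * U (s + 1) - U s > 0)
    {a b : ℕ} (ha : 1 ≤ a) (hb : 1 ≤ b) :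
    StrictMono fun s => U (s + a + b) - U (s + a) - (U (s + b) - U s) := by
  have h₁ : StrictMono fun s => (U (s + 1 + 1) - U (s + 1)) - (U (s + 1) - U s) := by
    refine strictMono_nat_of_lt_succ fun s => ?_
    have := hprud s
    simp only [add_assoc, Nat.reduceAdd]
    linarith
  have h₂ : StrictMono fun s => (U (s + 1 + b) - U (s + 1)) - (U (s + b) - U s) := by
    have h := strictMono_step_diff (f := fun s => U (s + 1) - U s) h₁ hb
    intro x y hxy
    have := h hxy
    simp only [add_right_comm _ 1 b] at this ⊢
    linarith
  exact strictMono_step_diff (f := fun s => U (s + b) - U s) h₂ ha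

/-- A rank-weighted sum over all subsets, rewritten in terms of single-element increments. -/
theorem sum_powerset_centered_card_eq {ι : Type*} [DecidableEq ι] (S : Finset ι)
    (G : Finset ι → ℝ) :
    ∑ I ∈ S.powerset, ((I.card.factorial * (S.card - I.card).factorial : ℕ) : ℝ) *
        (2 * I.card - S.card) * G I =
      ∑ j ∈ S, ∑ I ∈ (S.erase j).powerset,
        (((I.card + 1).factorial * (S.card - I.card).factorial : ℕ) : ℝ) *
          (G (insert j I) - G I) := by
  have key : ∀ j ∈ S, ∑ I ∈ (S.erase j).powerset,
        (((I.card + 1).factorial * (S.card - I.card).factorial : ℕ) : ℝ) *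
          (G (insert j I) - G I) =
      ∑ I ∈ S.powerset, if j ∈ I then
        ((I.card.factorial * (S.card + 1 - I.card).factorial : ℕ) : ℝ) * G I
        else -((((I.card + 1).factorial * (S.card - I.card).factorial : ℕ) : ℝ) * G I) := by
    intro j hj
    conv_rhs => rw [← Finset.insert_erase hj]
    rw [Finset.sum_powerset_insert (Finset.notMem_erase j S), ← Finset.sum_add_distrib]
    refine Finset.sum_congr rfl fun I hI => ?_
    have hjI : j ∉ I := fun h => Finset.notMem_erase j S (Finset.mem_powerset.1 hI h)
    rw [Finset.insert_erase hj, if_neg hjI, if_pos (Finset.mem_insert_self j I),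
      Finset.card_insert_of_notMem hjI, Nat.add_sub_add_right]
    ring
  rw [Finset.sum_congr rfl key, Finset.sum_comm]
  refine Finset.sum_congr rfl fun I hI => ?_
  have hIS := Finset.mem_powerset.1 hI
  have hle := Finset.card_le_card hIS
  rw [Finset.sum_ite, Finset.sum_const, Finset.sum_const, Finset.filter_mem_eq_inter,
    Finset.inter_eq_right.2 hIS, Finset.filter_notMem_eq_sdiff, Finset.card_sdiff_of_subset hIS,
    Nat.succ_sub hle, Nat.factorial_succ, Nat.factorial_succ]
  simp only [nsmul_eq_mul]
  push_cast [Nat.cast_sub hle]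
  ring

/-- The rank-weighted sum over subset sums is positive for increasing functions. -/
theorem sum_powerset_centered_card_pos {ι : Type*} [DecidableEq ι] {S : Finset ι}
    (hS : S.Nonempty) {t : ι → ℕ} (ht : ∀ i, 0 < t i) {g : ℕ → ℝ} (hg : StrictMono g) :
    0 < ∑ I ∈ S.powerset, ((I.card.factorial * (S.card - I.card).factorial : ℕ) : ℝ) *
        (2 * I.card - S.card) * g (∑ l ∈ I, t l) := by
  rw [sum_powerset_centered_card_eq S fun I => g (∑ l ∈ I, t l)]
  refine Finset.sum_pos (fun j _ => Finset.sum_pos (fun I hI => ?_) ⟨∅, by simp⟩) hS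
  have hjI : j ∉ I := fun h => Finset.notMem_erase j S (Finset.mem_powerset.1 hI h)
  refine mul_pos (by positivity) (sub_pos.2 (hg ?_))
  rw [Finset.sum_insert hjI]
  exact Nat.lt_add_of_pos_left (ht j)

/-- The Group Shapley Value of one group, conditioned on whether a fixed other group `m`
belongs to the coalition. -/
theorem EGSV_eq_sum_of_erase_eq {n N : ℕ} (U : ℕ → ℝ) (t : Fin (n + 2) → ℕ)
    (s : Fin N → ℕ) (e : Fin N ↪ Fin (n + 2)) (S : Finset (Fin N)) {x m : Fin (n + 2)}
    (hm : m ∉ S.map e) (hx : Finset.univ.erase x = insert m (S.map e))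
    (hs : ∀ i ∈ S, t (e i) = s i) :
    EGSV U t x = ∑ I ∈ S.powerset,
      (((I.card.factorial * (n + 1 - I.card).factorial : ℕ) : ℝ) / ((n + 2).factorial : ℕ) *
          (U ((∑ l ∈ I, s l) + t x) - U (∑ l ∈ I, s l)) +
        (((I.card + 1).factorial * (n - I.card).factorial : ℕ) : ℝ) / ((n + 2).factorial : ℕ) *
          (U ((∑ l ∈ I, s l) + t m + t x) - U ((∑ l ∈ I, s l) + t m))) := by
  have hpow : (S.map e).powerset = S.powerset.map (Finset.mapEmbedding e).toEmbedding := by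
    ext J
    simp [Finset.subset_map_iff, eq_comm]
  rw [EGSV, hx, Finset.sum_powerset_insert hm, ← Finset.sum_add_distrib, hpow, Finset.sum_map]
  refine Finset.sum_congr rfl fun I hI => ?_
  have hIS := Finset.mem_powerset.1 hI
  have hmI : m ∉ I.map e := fun h => hm (Finset.map_subset_map.2 hIS h)
  have hsum : ∑ l ∈ I.map e, t l = ∑ l ∈ I, s l := by
    rw [Finset.sum_map]
    exact Finset.sum_congr rfl fun i hi => hs i (hIS hi)
  simp only [RelEmbedding.coe_toEmbedding, Finset.mapEmbedding_apply,
    Finset.card_insert_of_notMem hmI, Finset.sum_insert hmI, hsum, Finset.card_map]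
  rw [add_comm (t m), show n + 2 - 1 = n + 1 from rfl, Nat.add_sub_add_right]

/-- Shell company attack: under the prudence condition, splitting a group strictly
increases the total expected Group Shapley Value received by its pieces. -/
theorem shell_company_attack
    (Ubar : ℕ → ℝ)
    (hprud : ∀ s : ℕ, Ubar (s + 3) - 3 * Ubar (s + 2) + 3 * Ubar (s + 1) - Ubar s > 0)
    (K : ℕ) (hK : 1 ≤ K)
    (t : Fin (K + 1) → ℕ) (ht : ∀ i, 0 < t i)
    (k : Fin (K + 1)) (a b : ℕ) (ha : 1 ≤ a) (hb : 1 ≤ b)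
    (hsplit : t k = a + b) :
    EGSV Ubar t k <
      EGSV Ubar (Fin.snoc (Function.update t k a) b) (Fin.castSucc k) +
        EGSV Ubar (Fin.snoc (Function.update t k a) b) (Fin.last (K + 1)) := by
  set S : Finset (Fin (K + 1)) := Finset.univ.erase k with hSdef
  set T : Fin (K + 2) → ℕ := Fin.snoc (Function.update t k a) b with hT
  have hScard : S.card = K := by simp [hSdef]
  have hS : S.Nonempty := Finset.card_pos.1 (by omega)
  have hTk : T k.castSucc = a := by simp [hT]
  have hTlast : T (Fin.last (K + 1)) = b := by rw [hT, Fin.snoc_last]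
  have hs : ∀ i ∈ S, T (Fin.castSuccEmb i) = t i := fun i hi => by
    rw [hT, Fin.coe_castSuccEmb, Fin.snoc_castSucc,
      Function.update_of_ne (Finset.ne_of_mem_erase hi)]
  have hkmem : k.castSucc ∉ S.map Fin.castSuccEmb := by simp [hSdef]
  have hlastmem : Fin.last (K + 1) ∉ S.map Fin.castSuccEmb := by
    simp [Fin.castSucc_ne_last]
  have hk : Finset.univ.erase k.castSucc =
      insert (Fin.last (K + 1)) (S.map Fin.castSuccEmb) := by
    ext i
    induction i using Fin.lastCases <;>
      simp [hSdef, Fin.castSucc_ne_last, (Fin.castSucc_ne_last _).symm]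
  have hlast : Finset.univ.erase (Fin.last (K + 1)) =
      insert k.castSucc (S.map Fin.castSuccEmb) := by
    ext i
    induction i using Fin.lastCases <;> simp [hSdef, Fin.castSucc_ne_last]
  rw [EGSV_eq_sum_of_erase_eq Ubar T t Fin.castSuccEmb S hlastmem hk hs,
    EGSV_eq_sum_of_erase_eq Ubar T t Fin.castSuccEmb S hkmem hlast hs, hTk, hTlast, EGSV, hsplit,
    ← sub_pos, ← Finset.sum_add_distrib, ← Finset.sum_sub_distrib]
  have hpos := sum_powerset_centered_card_pos hS ht (strictMono_mixed_diff hprud ha hb)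
  refine (div_pos hpos (Nat.cast_pos.2 (Nat.factorial_pos (K + 2)))).trans_eq ?_
  rw [Finset.sum_div]
  refine Finset.sum_congr rfl fun I hI => ?_
  have hle : I.card ≤ K := (Finset.card_le_card (Finset.mem_powerset.1 hI)).trans_eq hScard
  rw [hScard, Nat.add_sub_cancel, Nat.succ_sub hle, Nat.factorial_succ (K - I.card),
    Nat.factorial_succ I.card, Nat.factorial_succ (K + 1), add_right_comm _ b a, ← add_assoc _ a b]
  push_cast [Nat.cast_sub hle]
  rw [show (K : ℝ) + 1 + 1 = K + 2 by ring]
  field_simp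
  ring
end

section
/- Let Ū : ℕ → ℝ be any function, let t_0, …, t_K (K ≥ 1) be positive integers, fix k ∈ {0,…,K}, and let t_k = a + b with integers a, b ≥ 1. Let I_0 = {0,…,K}\{k}, and for x ∈ ℕ define Δ(x) = Ū(x+a) + Ū(x+b) − Ū(x) − Ū(x+a+b). Then the expected Group Shapley Values satisfy the exact identity EGSV_a + EGSV_b − EGSV_before = (1/((K+1)(K+2))) · Σ_{m=0}^{K} (K − 2m) · (Σ_{I ⊆ I_0, |I| = m} Δ(Σ_{l∈I} t_l)) / C(K, m), where EGSV_before is the expected Group Shapley Value of group k among the K+1 groups of sizes (t_0,…,t_K), and EGSV_a, EGSV_b are the expected Group Shapley Values of the subgroups of sizes a and b among the K+2 groups obtained by replacing the group of size t_k with two groups of sizes a and b. -/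
theorem Finset.sum_powerset_map {α β M : Type*} [AddCommMonoid M]
    (e : α ↪ β) (s : Finset α) (f : Finset β → M) :
    ∑ J ∈ (s.map e).powerset, f J = ∑ I ∈ s.powerset, f (I.map e) := by
  classical
  symm
  refine Finset.sum_bij (fun I _ => I.map e) ?_ ?_ ?_ (fun _ _ => rfl)
  · intro I hI
    exact Finset.mem_powerset.2 (Finset.map_subset_map.2 (Finset.mem_powerset.1 hI))
  · intro I _ J _ h
    exact Finset.map_injective e h
  · intro J hJ
    obtain ⟨I, hI, rfl⟩ := Finset.subset_map_iff.1 (Finset.mem_powerset.1 hJ)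
    exact ⟨I, Finset.mem_powerset.2 hI, rfl⟩

theorem Fin.univ_erase_castSucc {n : ℕ} (k : Fin (n + 1)) :
    (Finset.univ : Finset (Fin (n + 2))).erase k.castSucc =
      insert (Fin.last (n + 1)) ((Finset.univ.erase k).map Fin.castSuccEmb) := by
  ext i
  refine Fin.lastCases ?_ (fun j => ?_) i
  · simp [(Fin.castSucc_lt_last k).ne']
  · simp [(Fin.castSucc_lt_last j).ne]

theorem Fin.univ_erase_last {n : ℕ} (k : Fin (n + 1)) :
    (Finset.univ : Finset (Fin (n + 2))).erase (Fin.last (n + 1)) =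
      insert k.castSucc ((Finset.univ.erase k).map Fin.castSuccEmb) := by
  ext i
  refine Fin.lastCases ?_ (fun j => ?_) i
  · simp
  · simp [(Fin.castSucc_lt_last j).ne]

/-- The sizes of the groups in a coalition not containing `k` are unaffected by a split of `k`. -/
theorem sum_map_castSucc_snoc_update {n : ℕ} (t : Fin (n + 1) → ℕ) (k : Fin (n + 1)) (a b : ℕ)
    {I : Finset (Fin (n + 1))} (hI : k ∉ I) :
    ∑ l ∈ I.map Fin.castSuccEmb,
      (Fin.snoc (Function.update t k a) b : Fin (n + 2) → ℕ) l = ∑ l ∈ I, t l := by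
  rw [Finset.sum_map]
  refine Finset.sum_congr rfl fun l hl => ?_
  have hlk : l ≠ k := fun h => hI (h ▸ hl)
  simp [hlk]

theorem EGSV_snoc_castSucc (Ubar : ℕ → ℝ) {K : ℕ} (t : Fin (K + 1) → ℕ) (k : Fin (K + 1))
    (a b : ℕ) :
    EGSV Ubar (Fin.snoc (Function.update t k a) b) k.castSucc =
      ∑ I ∈ (Finset.univ.erase k).powerset,
        (((I.card.factorial * (K + 1 - I.card).factorial : ℕ) : ℝ) / ((K + 2).factorial : ℕ) *
            (Ubar ((∑ l ∈ I, t l) + a) - Ubar (∑ l ∈ I, t l)) +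
          (((I.card + 1).factorial * (K - I.card).factorial : ℕ) : ℝ) / ((K + 2).factorial : ℕ) *
            (Ubar ((∑ l ∈ I, t l) + a + b) - Ubar ((∑ l ∈ I, t l) + b))) := by
  have hlast : Fin.last (K + 1) ∉ (Finset.univ.erase k).map Fin.castSuccEmb := by
    simp [Fin.castSucc_ne_last]
  unfold EGSV
  rw [Fin.univ_erase_castSucc, Finset.sum_powerset_insert hlast, Finset.sum_powerset_map,
    Finset.sum_powerset_map, ← Finset.sum_add_distrib]
  refine Finset.sum_congr rfl fun I hI => ?_
  have hk : k ∉ I := fun h => Finset.notMem_erase k _ (Finset.mem_powerset.1 hI h)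
  have hl : Fin.last (K + 1) ∉ I.map Fin.castSuccEmb := by simp [Fin.castSucc_ne_last]
  rw [Finset.sum_insert hl, Finset.card_insert_of_notMem hl, sum_map_castSucc_snoc_update t k a b hk,
    Finset.card_map, Fin.snoc_castSucc, Fin.snoc_last, Function.update_self,
    show K + 1 + 1 - 1 - I.card = K + 1 - I.card by omega,
    show K + 1 + 1 - 1 - (I.card + 1) = K - I.card by omega,
    show b + ∑ l ∈ I, t l + a = ∑ l ∈ I, t l + a + b by omega, add_comm b]

theorem EGSV_snoc_last (Ubar : ℕ → ℝ) {K : ℕ} (t : Fin (K + 1) → ℕ) (k : Fin (K + 1))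
    (a b : ℕ) :
    EGSV Ubar (Fin.snoc (Function.update t k a) b) (Fin.last (K + 1)) =
      ∑ I ∈ (Finset.univ.erase k).powerset,
        (((I.card.factorial * (K + 1 - I.card).factorial : ℕ) : ℝ) / ((K + 2).factorial : ℕ) *
            (Ubar ((∑ l ∈ I, t l) + b) - Ubar (∑ l ∈ I, t l)) +
          (((I.card + 1).factorial * (K - I.card).factorial : ℕ) : ℝ) / ((K + 2).factorial : ℕ) *
            (Ubar ((∑ l ∈ I, t l) + a + b) - Ubar ((∑ l ∈ I, t l) + a))) := by
  have hcast : k.castSucc ∉ (Finset.univ.erase k).map Fin.castSuccEmb := by simp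
  unfold EGSV
  rw [Fin.univ_erase_last k, Finset.sum_powerset_insert hcast, Finset.sum_powerset_map,
    Finset.sum_powerset_map, ← Finset.sum_add_distrib]
  refine Finset.sum_congr rfl fun I hI => ?_
  have hk : k ∉ I := fun h => Finset.notMem_erase k _ (Finset.mem_powerset.1 hI h)
  have hl : k.castSucc ∉ I.map Fin.castSuccEmb := by simpa using hk
  rw [Finset.sum_insert hl, Finset.card_insert_of_notMem hl, sum_map_castSucc_snoc_update t k a b hk,
    Finset.card_map, Fin.snoc_castSucc, Fin.snoc_last, Function.update_self,
    show K + 1 + 1 - 1 - I.card = K + 1 - I.card by omega,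
    show K + 1 + 1 - 1 - (I.card + 1) = K - I.card by omega, add_comm a]

/-- Exact identity for the change of expected Group Shapley Value under a split of
group `k` of size `t k = a + b` into two groups of sizes `a` and `b`. -/
theorem gsv_split_identity
    (Ubar : ℕ → ℝ)
    (K : ℕ) (hK : 1 ≤ K)
    (t : Fin (K + 1) → ℕ) (ht : ∀ i, 0 < t i)
    (k : Fin (K + 1)) (a b : ℕ) (ha : 1 ≤ a) (hb : 1 ≤ b)
    (hsplit : t k = a + b) :
    EGSV Ubar (Fin.snoc (Function.update t k a) b) (Fin.castSucc k) +
        EGSV Ubar (Fin.snoc (Function.update t k a) b) (Fin.last (K + 1)) -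
        EGSV Ubar t k =
      1 / (((K : ℝ) + 1) * ((K : ℝ) + 2)) *
        ∑ m ∈ Finset.range (K + 1),
          ((K : ℝ) - 2 * m) *
            ((∑ I ∈ (Finset.univ.erase k).powerset.filter (fun I => I.card = m),
                (Ubar ((∑ l ∈ I, t l) + a) + Ubar ((∑ l ∈ I, t l) + b) -
                  Ubar (∑ l ∈ I, t l) - Ubar ((∑ l ∈ I, t l) + a + b))) /
              ((Nat.choose K m : ℕ) : ℝ)) := by
  have hcard : ∀ I ∈ (Finset.univ.erase k).powerset, I.card ≤ K := fun I hI => by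
    simpa using Finset.card_le_card (Finset.mem_powerset.1 hI)
  have hfiber := Finset.sum_fiberwise_of_maps_to (t := Finset.range (K + 1))
    (g := Finset.card) (fun I hI => Finset.mem_range.2 (Nat.lt_succ_of_le (hcard I hI)))
    (fun I => ((K : ℝ) - 2 * I.card) *
      ((Ubar ((∑ l ∈ I, t l) + a) + Ubar ((∑ l ∈ I, t l) + b) -
        Ubar (∑ l ∈ I, t l) - Ubar ((∑ l ∈ I, t l) + a + b)) / (K.choose I.card : ℝ)))
  have hsum : ∀ m ∈ Finset.range (K + 1),
      ((K : ℝ) - 2 * m) *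
        ((∑ I ∈ (Finset.univ.erase k).powerset.filter (fun I => I.card = m),
          (Ubar ((∑ l ∈ I, t l) + a) + Ubar ((∑ l ∈ I, t l) + b) -
            Ubar (∑ l ∈ I, t l) - Ubar ((∑ l ∈ I, t l) + a + b))) / (K.choose m : ℝ)) =
      ∑ I ∈ (Finset.univ.erase k).powerset.filter (fun I => I.card = m),
        ((K : ℝ) - 2 * I.card) *
          ((Ubar ((∑ l ∈ I, t l) + a) + Ubar ((∑ l ∈ I, t l) + b) -
            Ubar (∑ l ∈ I, t l) - Ubar ((∑ l ∈ I, t l) + a + b)) / (K.choose I.card : ℝ)) := by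
    intro m _
    rw [Finset.sum_div, Finset.mul_sum]
    refine Finset.sum_congr rfl fun I hI => ?_
    rw [(Finset.mem_filter.1 hI).2]
  rw [Finset.sum_congr rfl hsum, hfiber, EGSV_snoc_castSucc, EGSV_snoc_last, EGSV,
    ← Finset.sum_add_distrib, ← Finset.sum_sub_distrib, Finset.mul_sum]
  refine Finset.sum_congr rfl fun I hI => ?_
  obtain ⟨d, hd⟩ := Nat.exists_eq_add_of_le (hcard I hI)
  rw [hsplit, ← add_assoc (∑ l ∈ I, t l) a b, Nat.cast_choose ℝ (hcard I hI), Nat.add_sub_cancel,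
    show K + 1 - I.card = d + 1 by omega, show K - I.card = d by omega]
  have hKd : (K : ℝ) = I.card + d := by exact_mod_cast hd
  have hK0 := Nat.cast_ne_zero (R := ℝ).2 K.factorial_ne_zero
  have hm0 := Nat.cast_ne_zero (R := ℝ).2 I.card.factorial_ne_zero
  have hd0 := Nat.cast_ne_zero (R := ℝ).2 d.factorial_ne_zero
  have h1 : (K : ℝ) + 1 ≠ 0 := by positivity
  have h2 : (K : ℝ) + 2 ≠ 0 := by positivity
  simp only [Nat.factorial_succ, Nat.cast_mul, Nat.cast_add, Nat.cast_one]
  rw [show (K : ℝ) + 1 + 1 = K + 2 by ring]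
  field_simp
  rw [hKd]
  ring
end

section
/- Suppose Ū : ℕ → ℝ satisfies the prudence condition. Define the first difference ΔŪ(t) = Ū(t+1) − Ū(t) for t ≥ 0. Then for every integer x ≥ 0 and all positive integers a, b, it holds that ΔŪ(x) + ΔŪ(x + a + b) > ΔŪ(x + a) + ΔŪ(x + b). -/
/-- A real sequence with strictly increasing first differences has strictly increasing
differences over every positive step. -/
theorem add_lt_add_of_strictMono_sub (f : ℕ → ℝ) (hf : StrictMono fun t => f (t + 1) - f t)
    (x a b : ℕ) (ha : 1 ≤ a) (hb : 1 ≤ b) :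
    f (x + a) + f (x + b) < f x + f (x + a + b) := by
  induction b, hb using Nat.le_induction with
  | base =>
    have h := hf (show x < x + a by lia)
    dsimp only at h
    linarith
  | succ b _ ih =>
    have h := hf (show x + b < x + a + b by lia)
    dsimp only at h
    rw [← add_assoc, ← add_assoc]
    linarith

/-- Prudence implies that the first-order difference `ΔŪ(t) = Ū(t+1) − Ū(t)` is
strictly convex: `ΔŪ(x) + ΔŪ(x+a+b) > ΔŪ(x+a) + ΔŪ(x+b)` for positive `a, b`. -/
theorem prudence_first_difference_convex
    (Ubar : ℕ → ℝ)
    (hprud : ∀ s : ℕ, Ubar (s + 3) - 3 * Ubar (s + 2) + 3 * Ubar (s + 1) - Ubar s > 0)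
    (x a b : ℕ) (ha : 1 ≤ a) (hb : 1 ≤ b) :
    (Ubar (x + 1) - Ubar x) + (Ubar (x + a + b + 1) - Ubar (x + a + b)) >
      (Ubar (x + a + 1) - Ubar (x + a)) + (Ubar (x + b + 1) - Ubar (x + b)) := by
  refine add_lt_add_of_strictMono_sub (fun t => Ubar (t + 1) - Ubar t)
    (strictMono_nat_of_lt_succ fun t => ?_) x a b ha hb
  have h := hprud t
  simp only [add_assoc, Nat.reduceAdd]
  linarith
end

section
/- Suppose Ū : ℕ → ℝ satisfies the prudence condition. Fix positive integers a and b, and for x ∈ ℕ define Δ(x) = Ū(x+a) + Ū(x+b) − Ū(x) − Ū(x+a+b). Then Δ is strictly decreasing: for all integers x_2 > x_1 ≥ 0, Δ(x_1) > Δ(x_2). -/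
/-- If the forward differences of `f` are strictly increasing, then so are its differences
with any positive step. -/
theorem strictMono_sub_of_strictMono_fwdDiff {f : ℕ → ℝ}
    (hf : StrictMono fun x => f (x + 1) - f x) {n : ℕ} (hn : 1 ≤ n) :
    StrictMono fun x => f (x + n) - f x := by
  induction n, hn using Nat.le_induction with
  | base => exact hf
  | succ n _ ih =>
    intro x y hxy
    have h₁ := ih hxy
    have h₂ := hf (Nat.add_lt_add_right hxy n)
    simp only [← add_assoc] at h₁ h₂ ⊢
    linarith

/-- Under prudence, `Δ(x) = Ū(x+a) + Ū(x+b) − Ū(x) − Ū(x+a+b)` is strictly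
decreasing in `x`, for any fixed positive integers `a, b`. -/
theorem prudence_delta_strict_anti
    (Ubar : ℕ → ℝ)
    (hprud : ∀ s : ℕ, Ubar (s + 3) - 3 * Ubar (s + 2) + 3 * Ubar (s + 1) - Ubar s > 0)
    (a b : ℕ) (ha : 1 ≤ a) (hb : 1 ≤ b) :
    ∀ x1 x2 : ℕ, x1 < x2 →
      (Ubar (x2 + a) + Ubar (x2 + b) - Ubar x2 - Ubar (x2 + a + b)) <
        (Ubar (x1 + a) + Ubar (x1 + b) - Ubar x1 - Ubar (x1 + a + b)) := by
  intro x1 x2 hx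
  have h_second : StrictMono fun x =>
      (Ubar (x + 1 + 1) - Ubar (x + 1)) - (Ubar (x + 1) - Ubar x) := by
    refine strictMono_nat_of_lt_succ fun s => ?_
    have h := hprud s
    simp only [add_assoc, Nat.reduceAdd]
    linarith
  have h_step := strictMono_sub_of_strictMono_fwdDiff
    (f := fun x => Ubar (x + 1) - Ubar x) h_second hb
  have h_fwd : StrictMono fun x =>
      (Ubar (x + 1 + b) - Ubar (x + 1)) - (Ubar (x + b) - Ubar x) := by
    intro x y hxy
    have h := h_step hxy
    simp only [add_right_comm _ b 1] at h
    simp only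
    linarith
  have h := strictMono_sub_of_strictMono_fwdDiff
    (f := fun x => Ubar (x + b) - Ubar x) h_fwd ha hx
  simp only at h
  linarith
end

section
/- Let U assign a real number to every subset of [n] = {1,…,n}, let S0 ⊆ [n] with s0 = |S0|, and let FGSV(S0) = Σ_{i ∈ S0} SV(i). Then FGSV(S0) = (s0/n)·[U([n]) − U(∅)] + Σ_{s=1}^{n−1} T(s), where for each s, T(s) = Σ_{s1} [C(s0, s1)·C(n−s0, s−s1)/C(n, s)] · (n/(s(n−s))) · (s1 − s·s0/n) · μ(s1/s; s, s0, n), the sum being over integers s1 with max(0, s+s0−n) ≤ s1 ≤ min(s, s0). -/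
/-- The individual Shapley value of player `i` for utility `U` on `n` players. -/
noncomputable def SV (n : ℕ) (U : Finset (Fin n) → ℝ) (i : Fin n) : ℝ :=
  ∑ S ∈ ({i}ᶜ : Finset (Fin n)).powerset,
    ((Nat.factorial S.card * Nat.factorial (n - S.card - 1) : ℕ) : ℝ) /
        ((Nat.factorial n : ℕ) : ℝ) *
      (U (insert i S) - U S)

/-- `μ(s1/s; s, s0, n)`: the average of `U` over all size-`s` subsets `S ⊆ [n]`
with `|S ∩ S0| = s1`. -/
noncomputable def muFn (n : ℕ) (U : Finset (Fin n) → ℝ) (S0 : Finset (Fin n))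
    (s s1 : ℕ) : ℝ :=
  (∑ S ∈ (Finset.powersetCard s (Finset.univ : Finset (Fin n))).filter
      (fun S => (S ∩ S0).card = s1), U S) /
    ((Nat.choose S0.card s1 * Nat.choose (n - S0.card) (s - s1) : ℕ) : ℝ)

/-- The term `T(s)` in the closed-form expression of FGSV. -/
noncomputable def Tfn (n : ℕ) (U : Finset (Fin n) → ℝ) (S0 : Finset (Fin n))
    (s : ℕ) : ℝ :=
  ∑ s1 ∈ Finset.Icc (s + S0.card - n) (min s S0.card),
    ((Nat.choose S0.card s1 * Nat.choose (n - S0.card) (s - s1) : ℕ) : ℝ) /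
        ((Nat.choose n s : ℕ) : ℝ) *
      ((n : ℝ) / ((s : ℝ) * ((n : ℝ) - (s : ℝ)))) *
      ((s1 : ℝ) - (s : ℝ) * (S0.card : ℝ) / (n : ℝ)) *
      muFn n U S0 s s1

/-- The Shapley value written as a linear form in the values of `U`. -/
theorem SV_eq_sum (n : ℕ) (U : Finset (Fin n) → ℝ) (i : Fin n) :
    SV n U i = ∑ S : Finset (Fin n),
      (if i ∈ S then ((S.card - 1).factorial * (n - S.card).factorial : ℝ) / n.factorial
        else -((S.card.factorial * (n - S.card - 1).factorial : ℝ) / n.factorial)) * U S := by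
  have hfilter : ({i}ᶜ : Finset (Fin n)).powerset =
      Finset.univ.filter (fun S : Finset (Fin n) => i ∉ S) := by
    ext S
    simp
  rw [SV, hfilter, ← Finset.sum_filter_add_sum_filter_not Finset.univ
    (fun S : Finset (Fin n) => i ∈ S)]
  simp only [mul_sub, Finset.sum_sub_distrib]
  rw [sub_eq_add_neg, ← Finset.sum_neg_distrib]
  congr 1
  · refine Finset.sum_nbij' (insert i) (fun S => S.erase i) ?_ ?_ ?_ ?_ ?_
    · intro S _
      simp
    · intro S _
      simp
    · intro S hS
      exact Finset.erase_insert (Finset.mem_filter.mp hS).2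
    · intro S hS
      exact Finset.insert_erase (Finset.mem_filter.mp hS).2
    · intro S hS
      have hi : i ∉ S := (Finset.mem_filter.mp hS).2
      simp [Finset.card_insert_of_notMem hi, Nat.sub_sub]
  · refine Finset.sum_congr rfl fun S hS => ?_
    simp [(Finset.mem_filter.mp hS).2]

/-- The group Shapley value written as a linear form in the values of `U`. -/
theorem sum_SV_eq_sum (n : ℕ) (U : Finset (Fin n) → ℝ) (S0 : Finset (Fin n)) :
    ∑ i ∈ S0, SV n U i = ∑ S : Finset (Fin n),
      (((S ∩ S0).card : ℝ) *
          (((S.card - 1).factorial * (n - S.card).factorial : ℝ) / n.factorial) -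
        ((S0.card : ℝ) - (S ∩ S0).card) *
          ((S.card.factorial * (n - S.card - 1).factorial : ℝ) / n.factorial)) * U S := by
  simp only [SV_eq_sum]
  rw [Finset.sum_comm]
  refine Finset.sum_congr rfl fun S _ => ?_
  have hin : S0.filter (fun i => i ∈ S) = S ∩ S0 := by
    rw [Finset.filter_mem_eq_inter, Finset.inter_comm]
  have hcard := Finset.card_filter_add_card_filter_not (s := S0) (fun i => i ∈ S)
  rw [hin] at hcard
  have hcard' : ((S ∩ S0).card : ℝ) + (S0.filter (fun i => i ∉ S)).card = S0.card := by
    exact_mod_cast hcard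
  rw [← Finset.sum_mul, Finset.sum_ite, hin, Finset.sum_const, Finset.sum_const,
    nsmul_eq_mul, nsmul_eq_mul, ← hcard']
  ring

/-- For `0 < s < n`, the coefficient of `U S` in the group Shapley value, for `S` of size `s`
meeting the group in `a` of its `b` members. -/
theorem group_coeff_eq {n s : ℕ} (hs : 0 < s) (hsn : s < n) (a b : ℝ) :
    a * (((s - 1).factorial * (n - s).factorial : ℝ) / n.factorial) -
        (b - a) * ((s.factorial * (n - s - 1).factorial : ℝ) / n.factorial) =
      1 / (n.choose s : ℝ) * ((n : ℝ) / ((s : ℝ) * ((n : ℝ) - (s : ℝ)))) *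
        (a - (s : ℝ) * b / (n : ℝ)) := by
  obtain ⟨k, rfl⟩ := Nat.exists_eq_add_of_lt hsn
  obtain ⟨m, rfl⟩ := Nat.exists_eq_succ_of_ne_zero hs.ne'
  have h1 : m.succ + k + 1 - m.succ = k + 1 := by omega
  have hc : ((m.succ + k + 1).choose m.succ : ℝ) =
      (m.succ + k + 1).factorial / (m.succ.factorial * (k + 1).factorial) := by
    rw [Nat.cast_choose ℝ hsn.le, h1]
  rw [hc, h1]
  have hd : (m : ℝ) + 1 + k + 1 - (m + 1) = k + 1 := by ring
  simp only [Nat.succ_eq_add_one, Nat.add_sub_cancel, Nat.factorial_succ]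
  push_cast
  rw [hd]
  field_simp
  ring

/-- `T(s)` is a linear form in the values of `U` on sets of size `s`. -/
theorem Tfn_eq_sum {n s : ℕ} (U : Finset (Fin n) → ℝ) (S0 : Finset (Fin n)) :
    Tfn n U S0 s = ∑ S ∈ Finset.powersetCard s (Finset.univ : Finset (Fin n)),
      1 / (n.choose s : ℝ) * ((n : ℝ) / ((s : ℝ) * ((n : ℝ) - (s : ℝ)))) *
        (((S ∩ S0).card : ℝ) - (s : ℝ) * S0.card / (n : ℝ)) * U S := by
  have hS0 : S0.card ≤ n := by simpa using S0.card_le_univ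
  have hmaps : ∀ S ∈ Finset.powersetCard s (Finset.univ : Finset (Fin n)),
      (S ∩ S0).card ∈ Finset.Icc (s + S0.card - n) (min s S0.card) := by
    intro S hS
    have hcard := (Finset.mem_powersetCard.mp hS).2
    have h1 := Finset.card_union_add_card_inter S S0
    have h2 : (S ∪ S0).card ≤ n := by simpa using (S ∪ S0).card_le_univ
    have h3 := Finset.card_le_card (Finset.inter_subset_left (s₁ := S) (s₂ := S0))
    have h4 := Finset.card_le_card (Finset.inter_subset_right (s₁ := S) (s₂ := S0))
    rw [Finset.mem_Icc, le_min_iff]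
    omega
  rw [← Finset.sum_fiberwise_of_maps_to hmaps, Tfn]
  refine Finset.sum_congr rfl fun s1 hs1 => ?_
  rw [Finset.mem_Icc, le_min_iff] at hs1
  have hpos : 0 < S0.card.choose s1 * (n - S0.card).choose (s - s1) :=
    Nat.mul_pos (Nat.choose_pos hs1.2.2) (Nat.choose_pos (by omega))
  have hne : ((S0.card.choose s1 * (n - S0.card).choose (s - s1) : ℕ) : ℝ) ≠ 0 := by
    exact_mod_cast hpos.ne'
  have hfiber : ∀ S ∈ (Finset.powersetCard s (Finset.univ : Finset (Fin n))).filter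
      (fun S => (S ∩ S0).card = s1),
      1 / (n.choose s : ℝ) * ((n : ℝ) / ((s : ℝ) * ((n : ℝ) - (s : ℝ)))) *
        (((S ∩ S0).card : ℝ) - (s : ℝ) * S0.card / (n : ℝ)) * U S =
      1 / (n.choose s : ℝ) * ((n : ℝ) / ((s : ℝ) * ((n : ℝ) - (s : ℝ)))) *
        ((s1 : ℝ) - (s : ℝ) * S0.card / (n : ℝ)) * U S := by
    intro S hS
    rw [(Finset.mem_filter.mp hS).2]
  rw [Finset.sum_congr rfl hfiber, ← Finset.mul_sum, muFn]
  generalize ((S0.card.choose s1 * (n - S0.card).choose (s - s1) : ℕ) : ℝ) = c at hne ⊢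
  generalize (n : ℝ) / ((s : ℝ) * ((n : ℝ) - (s : ℝ))) = d
  generalize (s1 : ℝ) - (s : ℝ) * S0.card / (n : ℝ) = e
  rw [div_eq_mul_inv c, div_eq_mul_inv _ c, one_div]
  linear_combination ((n.choose s : ℝ)⁻¹ * d * e * ∑ S ∈ (Finset.powersetCard s
    (Finset.univ : Finset (Fin n))).filter (fun S => (S ∩ S0).card = s1), U S) *
    mul_inv_cancel₀ hne

/-- Closed-form rewriting of the Faithful Group Shapley Value:
`FGSV(S0) = (s0/n)(U([n]) − U(∅)) + Σ_{s=1}^{n−1} T(s)`. -/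
theorem FGSV_closed_form (n : ℕ) (U : Finset (Fin n) → ℝ) (S0 : Finset (Fin n)) :
    ∑ i ∈ S0, SV n U i =
      (S0.card : ℝ) / (n : ℝ) * (U Finset.univ - U ∅) +
        ∑ s ∈ Finset.Icc 1 (n - 1), Tfn n U S0 s := by
  rcases n with _ | m
  · simp [Finset.eq_empty_of_isEmpty S0]
  have hfact : ((m + 1).factorial : ℝ) = (m + 1) * m.factorial := by
    push_cast [Nat.factorial_succ]
    ring
  have hm : (m.factorial : ℝ) ≠ 0 := by exact_mod_cast m.factorial_ne_zero
  have hm1 : (m : ℝ) + 1 ≠ 0 := by positivity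
  have htop : Finset.powersetCard (m + 1) (Finset.univ : Finset (Fin (m + 1))) =
      {Finset.univ} := by
    simpa using Finset.powersetCard_self (Finset.univ : Finset (Fin (m + 1)))
  rw [sum_SV_eq_sum, ← Finset.powerset_univ, Finset.sum_powerset, Finset.card_univ,
    Fintype.card_fin, Finset.sum_range_succ, Finset.sum_range_succ', htop,
    Finset.powersetCard_zero, Finset.sum_singleton, Finset.sum_singleton, Nat.add_sub_cancel]
  have hshift : ∑ s ∈ Finset.Icc 1 m, Tfn (m + 1) U S0 s =
      ∑ k ∈ Finset.range m, Tfn (m + 1) U S0 (k + 1) := by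
    rw [Finset.range_eq_Ico, Finset.sum_Ico_add' (Tfn (m + 1) U S0) 0 m 1, zero_add,
      Finset.Ico_add_one_right_eq_Icc]
  have hmid : ∀ k ∈ Finset.range m, Tfn (m + 1) U S0 (k + 1) =
      ∑ S ∈ Finset.powersetCard (k + 1) (Finset.univ : Finset (Fin (m + 1))),
        (((S ∩ S0).card : ℝ) * (((S.card - 1).factorial * (m + 1 - S.card).factorial : ℝ) /
            (m + 1).factorial) -
          ((S0.card : ℝ) - (S ∩ S0).card) *
            ((S.card.factorial * (m + 1 - S.card - 1).factorial : ℝ) / (m + 1).factorial)) *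
          U S := by
    intro k hk
    rw [Finset.mem_range] at hk
    rw [Tfn_eq_sum U S0]
    refine Finset.sum_congr rfl fun S hS => ?_
    rw [(Finset.mem_powersetCard.mp hS).2, group_coeff_eq (by omega) (by omega)]
  rw [hshift, Finset.sum_congr rfl hmid]
  simp [hfact]
  field_simp
  ring
end

section
/- Let U assign a real number to every subset of [n], let S0 ⊆ [n] with s0 = |S0|, and suppose U satisfies the second-order stability condition with constants C > 0 and υ > 0. Then there is a constant C' depending only on C and υ such that for every s ∈ {3,…,n−1} and every integer s1 for which all three values s1−1, s1, s1+1 lie in the range [max(0, s+s0−n), min(s, s0)], one has |μ((s1+1)/s; s, s0, n) − 2·μ(s1/s; s, s0, n) + μ((s1−1)/s; s, s0, n)| ≤ C' / s^{3/2+υ}. -/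
/-- Second-order algorithmic stability of the utility `U` with constants `C, υ`. -/
def SecondOrderStable (n : ℕ) (U : Finset (Fin n) → ℝ) (C υ : ℝ) : Prop :=
  ∀ S : Finset (Fin n), 1 ≤ S.card →
    ∀ z1 z1' z2 z2' : Fin n, z1 ∉ S → z1' ∉ S → z2 ∉ S → z2' ∉ S →
      z1 ≠ z1' → z1 ≠ z2 → z1 ≠ z2' → z1' ≠ z2 → z1' ≠ z2' → z2 ≠ z2' →
      |U (S ∪ {z1, z1'}) - U (S ∪ {z1, z2}) - U (S ∪ {z1', z2'}) + U (S ∪ {z2, z2'})| ≤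
        C * (S.card : ℝ) ^ (-(3 / 2 + υ) : ℝ)

open scoped Pointwise in
/-- Two subsets of a finite type with the same cardinality and the same trace size on `S0` are
related by a permutation stabilizing `S0`. -/
lemma exists_stabilizer_smul_eq {α : Type*} [Fintype α] [DecidableEq α] {S0 T T' : Finset α}
    (hcard : T.card = T'.card) (hinter : (T ∩ S0).card = (T' ∩ S0).card) :
    ∃ g : MulAction.stabilizer (Equiv.Perm α) S0, g • T = T' := by
  classical
  have hfib : ∀ c : Prop × Prop, Nonempty
      ({a // ((a ∈ T, a ∈ S0) : Prop × Prop) = c} ≃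
        {b // ((b ∈ T', b ∈ S0) : Prop × Prop) = c}) := by
    rintro ⟨p, q⟩
    refine ⟨Fintype.equivOfCardEq ?_⟩
    rw [Fintype.card_subtype, Fintype.card_subtype]
    have h1 := Finset.card_sdiff_add_card_inter T S0
    have h2 := Finset.card_sdiff_add_card_inter T' S0
    have h3 := Finset.card_sdiff_add_card_inter S0 T
    have h4 := Finset.card_sdiff_add_card_inter S0 T'
    rw [Finset.inter_comm] at h3 h4
    have h5 := Finset.card_union_add_card_inter T S0
    have h6 := Finset.card_union_add_card_inter T' S0
    have h7 := Finset.card_compl_add_card (T ∪ S0)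
    have h8 := Finset.card_compl_add_card (T' ∪ S0)
    by_cases hp : p <;> by_cases hq : q
    · convert hinter using 2 <;> ext x <;> simp [hp, hq]
    · have : (T \ S0).card = (T' \ S0).card := by omega
      convert this using 2 <;> ext x <;> simp [hp, hq]
    · have : (S0 \ T).card = (S0 \ T').card := by omega
      convert this using 2 <;> ext x <;> simp [hp, hq, and_comm]
    · have : (T ∪ S0)ᶜ.card = (T' ∪ S0)ᶜ.card := by omega
      convert this using 2 <;> ext x <;> simp [hp, hq]
  let e : Equiv.Perm α := Equiv.ofFiberEquiv fun c => (hfib c).some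
  have he : ∀ a, ((e a ∈ T', e a ∈ S0) : Prop × Prop) = (a ∈ T, a ∈ S0) := fun a =>
    Equiv.ofFiberEquiv_map (fun c => (hfib c).some) a
  have hT : ∀ a, e a ∈ T' ↔ a ∈ T := fun a => iff_of_eq (congrArg Prod.fst (he a))
  have hS : ∀ a, e a ∈ S0 ↔ a ∈ S0 := fun a => iff_of_eq (congrArg Prod.snd (he a))
  refine ⟨⟨e, ?_⟩, ?_⟩
  · rw [MulAction.mem_stabilizer_iff]
    ext x
    obtain ⟨y, rfl⟩ := e.surjective x
    rw [hS, ← Equiv.Perm.smul_def, Finset.smul_mem_smul_finset_iff]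
  · ext x
    obtain ⟨y, rfl⟩ := e.surjective x
    change e • y ∈ e • T ↔ _
    rw [hT, Finset.smul_mem_smul_finset_iff]

/-- The number of `s`-subsets of a finite type meeting `S0` in exactly `k` points. -/
lemma card_filter_powersetCard_inter {α : Type*} [Fintype α] [DecidableEq α] (S0 : Finset α)
    {s k : ℕ} (hk : k ≤ s) :
    ((Finset.powersetCard s (Finset.univ : Finset α)).filter
      (fun S => (S ∩ S0).card = k)).card =
      S0.card.choose k * (Fintype.card α - S0.card).choose (s - k) := by
  rw [← Finset.card_compl, ← Finset.card_powersetCard, ← Finset.card_powersetCard,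
    ← Finset.card_product]
  refine Finset.card_nbij' (fun S => (S ∩ S0, S ∩ S0ᶜ)) (fun p => p.1 ∪ p.2) ?_ ?_ ?_ ?_
  · intro S hS
    have h := Finset.card_sdiff_add_card_inter S S0
    simp only [Finset.coe_filter, Finset.mem_powersetCard, Set.mem_ofPred_eq] at hS
    simp only [Finset.coe_product, Set.mem_prod, Finset.mem_coe, Finset.mem_powersetCard]
    refine ⟨⟨Finset.inter_subset_right, hS.2⟩, Finset.inter_subset_right, ?_⟩
    rw [← Finset.sdiff_eq_inter_compl]
    omega
  · rintro ⟨A, B⟩ h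
    simp only [Finset.coe_product, Set.mem_prod, Finset.mem_coe, Finset.mem_powersetCard] at h
    obtain ⟨⟨hA, hAk⟩, hB, hBk⟩ := h
    have hBd : Disjoint B S0 := Finset.subset_compl_iff_disjoint_right.mp hB
    have hAB : Disjoint A B := hBd.symm.mono_left hA
    simp only [Finset.coe_filter, Finset.mem_powersetCard, Set.mem_ofPred_eq]
    refine ⟨⟨Finset.subset_univ _, ?_⟩, ?_⟩
    · rw [Finset.card_union_of_disjoint hAB]
      omega
    · rw [Finset.union_inter_distrib_right, Finset.inter_eq_left.mpr hA,
        Finset.disjoint_iff_inter_eq_empty.mp hBd, Finset.union_empty, hAk]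
  · intro S _
    ext x
    by_cases hx : x ∈ S0 <;> simp [hx]
  · rintro ⟨A, B⟩ h
    simp only [Finset.coe_product, Set.mem_prod, Finset.mem_coe, Finset.mem_powersetCard] at h
    obtain ⟨⟨hA, -⟩, hB, -⟩ := h
    have hB' : ∀ x ∈ B, x ∉ S0 := fun x hx => Finset.mem_compl.mp (hB hx)
    ext x <;> have h1 := @hA x <;> have h2 := hB' x <;> simp <;> tauto

open scoped Pointwise in
/-- `muFn` is an average over the orbit of any set under the stabilizer of `S0`. -/
lemma sum_stabilizer_smul_eq (n : ℕ) (U : Finset (Fin n) → ℝ) (S0 T : Finset (Fin n))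
    [Fintype (MulAction.stabilizer (Equiv.Perm (Fin n)) S0)] :
    ∑ g : MulAction.stabilizer (Equiv.Perm (Fin n)) S0, U (g • T) =
      Fintype.card (MulAction.stabilizer (Equiv.Perm (Fin n)) S0) *
        muFn n U S0 T.card (T ∩ S0).card := by
  classical
  set F := (Finset.powersetCard T.card (Finset.univ : Finset (Fin n))).filter
    (fun S => (S ∩ S0).card = (T ∩ S0).card) with hF
  have hmem : ∀ S, S ∈ F ↔ S.card = T.card ∧ (S ∩ S0).card = (T ∩ S0).card := by
    simp [hF, Finset.mem_powersetCard]
  have hFcard := card_filter_powersetCard_inter S0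
    (Finset.card_le_card (Finset.inter_subset_left : T ∩ S0 ⊆ T))
  rw [← hF, Fintype.card_fin] at hFcard
  have hFpos : (F.card : ℝ) ≠ 0 := by
    have : T ∈ F := (hmem T).2 ⟨rfl, rfl⟩
    exact_mod_cast (Finset.card_pos.mpr ⟨T, this⟩).ne'
  have horbit : ∀ S ∈ F, ∑ g : MulAction.stabilizer (Equiv.Perm (Fin n)) S0, U (g • S) =
      ∑ g : MulAction.stabilizer (Equiv.Perm (Fin n)) S0, U (g • T) := by
    intro S hS
    obtain ⟨h, rfl⟩ := exists_stabilizer_smul_eq ((hmem S).1 hS).1 ((hmem S).1 hS).2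
    refine Fintype.sum_equiv (Equiv.mulRight h⁻¹) _ _ fun g => ?_
    rw [Equiv.coe_mulRight, smul_smul, inv_mul_cancel_right]
  have hperm : ∀ g : MulAction.stabilizer (Equiv.Perm (Fin n)) S0,
      ∑ S ∈ F, U (g • S) = ∑ S ∈ F, U S := by
    have hmaps : ∀ (g : MulAction.stabilizer (Equiv.Perm (Fin n)) S0), ∀ S ∈ F, g • S ∈ F := by
      intro g S hS
      rw [hmem] at hS ⊢
      have hg : g • S0 = S0 := g.2
      have hinter : g • S ∩ S0 = g • (S ∩ S0) := by
        exact (congrArg (g • S ∩ ·) hg.symm).trans (Finset.smul_finset_inter (a := g.1)).symm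
      rw [hinter]
      exact ⟨(Finset.card_smul_finset g.1 S).trans hS.1,
        (Finset.card_smul_finset g.1 (S ∩ S0)).trans hS.2⟩
    intro g
    exact Finset.sum_nbij' (fun S => g • S) (fun S => g⁻¹ • S) (hmaps g) (hmaps g⁻¹)
      (fun S _ => inv_smul_smul g S) (fun S _ => smul_inv_smul g S) (fun _ _ => rfl)
  have hdouble := Finset.sum_congr rfl horbit
  rw [Finset.sum_comm, Finset.sum_congr rfl fun g _ => hperm g] at hdouble
  simp only [Finset.sum_const, nsmul_eq_mul, Finset.card_univ] at hdouble
  rw [muFn, ← hF, ← hFcard, ← mul_div_assoc, hdouble, mul_div_cancel_left₀ _ hFpos]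

open scoped Pointwise in
/-- The second difference of `muFn` is bounded by the stability bound at sets of size `s - 2`. -/
lemma SecondOrderStable.abs_muFn_second_difference_le {n : ℕ} {U : Finset (Fin n) → ℝ} {C υ : ℝ}
    (hU : SecondOrderStable n U C υ) {S0 S : Finset (Fin n)} (hS : 1 ≤ S.card)
    {z1 z1' z2 z2' : Fin n} (hz1 : z1 ∈ S0 \ S) (hz1' : z1' ∈ S0 \ S) (hne : z1 ≠ z1')
    (hz2 : z2 ∈ S0ᶜ \ S) (hz2' : z2' ∈ S0ᶜ \ S) (hne' : z2 ≠ z2') :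
    |muFn n U S0 (S.card + 2) ((S ∩ S0).card + 2)
        - 2 * muFn n U S0 (S.card + 2) ((S ∩ S0).card + 1)
        + muFn n U S0 (S.card + 2) (S ∩ S0).card| ≤
      C * (S.card : ℝ) ^ (-(3 / 2 + υ) : ℝ) := by
  classical
  simp only [Finset.mem_sdiff, Finset.mem_compl] at hz1 hz1' hz2 hz2'
  have h12 : ∀ {x y : Fin n}, x ∈ S0 → y ∉ S0 → x ≠ y := fun hx hy h => hy (h ▸ hx)
  have hcard : ∀ {x y : Fin n}, x ∉ S → y ∉ S → x ≠ y → (S ∪ {x, y}).card = S.card + 2 := by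
    intro x y hx hy hxy
    rw [Finset.card_union_of_disjoint (by simp [hx, hy]), Finset.card_pair hxy]
  have e1 := sum_stabilizer_smul_eq n U S0 (S ∪ {z1, z1'})
  have e2 := sum_stabilizer_smul_eq n U S0 (S ∪ {z1, z2})
  have e3 := sum_stabilizer_smul_eq n U S0 (S ∪ {z1', z2'})
  have e4 := sum_stabilizer_smul_eq n U S0 (S ∪ {z2, z2'})
  have i1 : ((S ∪ {z1, z1'}) ∩ S0).card = (S ∩ S0).card + 2 := by
    have : (S ∪ {z1, z1'}) ∩ S0 = (S ∩ S0) ∪ {z1, z1'} := by grind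
    rw [this, Finset.card_union_of_disjoint (by simp [hz1, hz1']), Finset.card_pair hne]
  have hmixed : ∀ {x y : Fin n}, x ∈ S0 → x ∉ S → y ∉ S0 →
      ((S ∪ {x, y}) ∩ S0).card = (S ∩ S0).card + 1 := by
    intro x y hx hxS hy
    have : (S ∪ {x, y}) ∩ S0 = insert x (S ∩ S0) := by grind
    rw [this, Finset.card_insert_of_notMem (by simp [hxS])]
  have i4 : (S ∪ {z2, z2'}) ∩ S0 = S ∩ S0 := by grind
  rw [hcard hz1.2 hz1'.2 hne, i1] at e1
  rw [hcard hz1.2 hz2.2 (h12 hz1.1 hz2.1), hmixed hz1.1 hz1.2 hz2.1] at e2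
  rw [hcard hz1'.2 hz2'.2 (h12 hz1'.1 hz2'.1), hmixed hz1'.1 hz1'.2 hz2'.1] at e3
  rw [hcard hz2.2 hz2'.2 hne', i4] at e4
  set N : ℝ := ((Fintype.card (MulAction.stabilizer (Equiv.Perm (Fin n)) S0) : ℕ) : ℝ) with hN
  have hNpos : 0 < N := by
    rw [hN]
    exact_mod_cast Fintype.card_pos
  have hterm : ∀ g : MulAction.stabilizer (Equiv.Perm (Fin n)) S0,
      |U (g • (S ∪ {z1, z1'})) - U (g • (S ∪ {z1, z2})) - U (g • (S ∪ {z1', z2'}))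
        + U (g • (S ∪ {z2, z2'}))| ≤ C * (S.card : ℝ) ^ (-(3 / 2 + υ) : ℝ) := by
    rintro ⟨g, hg⟩
    have hpair : ∀ x y : Fin n, g • (S ∪ {x, y}) = g • S ∪ {g x, g y} := by
      intro x y
      rw [Finset.smul_finset_union, Finset.smul_finset_insert, Finset.smul_finset_singleton]
      rfl
    have hnot : ∀ {x : Fin n}, x ∉ S → g x ∉ g • S := fun {x} hx h =>
      hx (Finset.smul_mem_smul_finset_iff g |>.mp h)
    change |U (g • _) - U (g • _) - U (g • _) + U (g • _)| ≤ _
    simp only [hpair]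
    have := hU (g • S) (by rwa [Finset.card_smul_finset]) (g z1) (g z1') (g z2) (g z2')
      (hnot hz1.2) (hnot hz1'.2) (hnot hz2.2) (hnot hz2'.2) (g.injective.ne hne)
      (g.injective.ne (h12 hz1.1 hz2.1)) (g.injective.ne (h12 hz1.1 hz2'.1))
      (g.injective.ne (h12 hz1'.1 hz2.1)) (g.injective.ne (h12 hz1'.1 hz2'.1))
      (g.injective.ne hne')
    rwa [Finset.card_smul_finset] at this
  have hsum := (Finset.abs_sum_le_sum_abs _ _).trans
    (Finset.sum_le_sum fun g (_ : g ∈ Finset.univ) => hterm g)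
  rw [Finset.sum_add_distrib, Finset.sum_sub_distrib, Finset.sum_sub_distrib, e1, e2, e3, e4,
    Finset.sum_const, Finset.card_univ, nsmul_eq_mul, ← hN] at hsum
  refine le_of_mul_le_mul_left ?_ hNpos
  rw [← abs_of_pos hNpos, ← abs_mul, abs_of_pos hNpos]
  convert hsum using 1
  ring_nf

/-- Second-order stability of `U` implies a second-order finite-difference bound on `μ`. -/
theorem mu_second_order_stability (C υ : ℝ) (hC : 0 < C) (hυ : 0 < υ) :
    ∃ C' : ℝ, ∀ (n : ℕ) (U : Finset (Fin n) → ℝ) (S0 : Finset (Fin n)),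
      SecondOrderStable n U C υ →
      ∀ s : ℕ, 3 ≤ s → s ≤ n - 1 →
        ∀ s1 : ℕ, 1 ≤ s1 → s + S0.card - n ≤ s1 - 1 → s1 + 1 ≤ min s S0.card →
          |muFn n U S0 s (s1 + 1) - 2 * muFn n U S0 s s1 + muFn n U S0 s (s1 - 1)| ≤
            C' / (s : ℝ) ^ ((3 : ℝ) / 2 + υ) := by
  refine ⟨C * 3 ^ ((3 : ℝ) / 2 + υ), ?_⟩
  intro n U S0 hU s hs _ s1 hs1 hlow hhigh
  have hcompl : S0ᶜ.card = n - S0.card := by rw [Finset.card_compl, Fintype.card_fin]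
  rw [le_min_iff] at hhigh
  obtain ⟨A, hA, hAcard⟩ := Finset.exists_subset_card_eq (s := S0) (n := s1 - 1) (by omega)
  obtain ⟨B, hB, hBcard⟩ := Finset.exists_subset_card_eq (s := S0ᶜ) (n := s - s1 - 1) (by omega)
  have hBd : Disjoint B S0 := Finset.subset_compl_iff_disjoint_right.mp hB
  have hAB : Disjoint A B := hBd.symm.mono_left hA
  have hcard : (A ∪ B).card = s - 2 := by
    rw [Finset.card_union_of_disjoint hAB]
    omega
  have hinter : (A ∪ B) ∩ S0 = A := by
    rw [Finset.union_inter_distrib_right, Finset.inter_eq_left.mpr hA,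
      Finset.disjoint_iff_inter_eq_empty.mp hBd, Finset.union_empty]
  have hdiff : S0 \ (A ∪ B) = S0 \ A := by
    rw [Finset.sdiff_union_distrib, Finset.sdiff_eq_self_of_disjoint hBd.symm,
      Finset.inter_eq_left.mpr Finset.sdiff_subset]
  have hdiff' : S0ᶜ \ (A ∪ B) = S0ᶜ \ B := by
    rw [Finset.sdiff_union_distrib,
      Finset.sdiff_eq_self_of_disjoint (disjoint_compl_left.mono_right hA),
      Finset.inter_eq_right.mpr Finset.sdiff_subset]
  have hroom : 1 < (S0 \ (A ∪ B)).card := by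
    rw [hdiff, Finset.card_sdiff_of_subset hA]
    omega
  have hroom' : 1 < (S0ᶜ \ (A ∪ B)).card := by
    rw [hdiff', Finset.card_sdiff_of_subset hB]
    omega
  obtain ⟨z1, hz1, z1', hz1', hne⟩ := Finset.one_lt_card.mp hroom
  obtain ⟨z2, hz2, z2', hz2', hne'⟩ := Finset.one_lt_card.mp hroom'
  have key := hU.abs_muFn_second_difference_le (by omega) hz1 hz1' hne hz2 hz2' hne'
  rw [hinter, hcard, hAcard, show s - 2 + 2 = s by omega, show s1 - 1 + 2 = s1 + 1 by omega,
    show s1 - 1 + 1 = s1 by omega] at key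
  refine key.trans ?_
  have hspos : (0 : ℝ) < s := by
    exact_mod_cast (by omega : 0 < s)
  have hs3 : (s : ℝ) / 3 ≤ ((s - 2 : ℕ) : ℝ) := by
    have h : s ≤ 3 * (s - 2) := by omega
    have h' : (s : ℝ) ≤ 3 * ((s - 2 : ℕ) : ℝ) := by exact_mod_cast h
    linarith
  have hpow := Real.rpow_le_rpow_of_nonpos (by positivity : (0 : ℝ) < s / 3) hs3
    (by linarith : -((3 : ℝ) / 2 + υ) ≤ 0)
  rw [Real.rpow_neg (by positivity : (0 : ℝ) ≤ s / 3),
    Real.div_rpow hspos.le (by norm_num), inv_div] at hpow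
  rw [mul_div_assoc]
  exact mul_le_mul_of_nonneg_left hpow hC.le
end

section
/- Let U assign a real number to every subset of [n] with |U(S)| ≤ C_b for all S, let S0 ⊆ [n] with s0 = |S0| and 1 ≤ s0 ≤ n−1, and suppose U satisfies the second-order stability condition with constants C > 0 and υ > 0. Set α0 = s0/n. Then there is a constant C'' depending only on C_b, C, and υ such that for every s ∈ {1,…,n−1}, with s1* = ⌊s·s0/n⌋: |T(s) − (n/(n−1))·α0·(1−α0)·Δμ(s1*/s; s, s0, n)| ≤ C''·(n/(n−1))·α0·(1−α0)·s^{−(1+υ)}, where Δμ(s1/s; s, s0, n) = μ((s1+1)/s; s, s0, n) − μ(s1/s; s, s0, n). -/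
open Finset

lemma cast_choose_succ_mul (M k : ℕ) :
    ((M.choose (k + 1) : ℕ) : ℝ) * ((k : ℝ) + 1) = (M.choose k : ℝ) * ((M : ℝ) - k) := by
  rcases le_or_gt k M with h | h
  · have := Nat.choose_succ_right_eq M k
    rw [← Nat.cast_sub h]
    exact_mod_cast this
  · rw [Nat.choose_eq_zero_of_lt h, Nat.choose_eq_zero_of_lt (by omega)]
    simp

/-- The number of `r`-subsets of an `(M + L)`-set meeting a fixed `M`-subset in `k` points. -/
def hyperCount (M L r k : ℕ) : ℕ := M.choose k * L.choose (r - k)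

lemma sum_hyperCount (M L r : ℕ) :
    ∑ k ∈ range (r + 1), (hyperCount M L r k : ℝ) = ((M + L).choose r : ℝ) := by
  rw [Nat.add_choose_eq, Nat.sum_antidiagonal_eq_sum_range_succ_mk]
  simp [hyperCount]

lemma hyperCount_succ (M L r k : ℕ) (hk : k < r) :
    (hyperCount M L r (k + 1) : ℝ) * (((k : ℝ) + 1) * ((L : ℝ) - r + k + 1)) =
      hyperCount M L r k * (((M : ℝ) - k) * ((r : ℝ) - k)) := by
  obtain ⟨d, rfl⟩ : ∃ d, r = k + 1 + d := ⟨r - (k + 1), by omega⟩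
  have h1 := cast_choose_succ_mul M k
  have h2 := cast_choose_succ_mul L d
  have e1 : k + 1 + d - (k + 1) = d := by omega
  have e2 : k + 1 + d - k = d + 1 := by omega
  simp only [hyperCount, e1, e2]
  push_cast
  linear_combination (L.choose d : ℝ) * ((L : ℝ) - d) * h1 -
    (M.choose k : ℝ) * ((M : ℝ) - k) * h2

/-- The Stein identity for the hypergeometric distribution. -/
lemma sum_hyperCount_mul_sub_mean (M L r : ℕ) (f : ℕ → ℝ) :
    ∑ k ∈ range (r + 1),
        (hyperCount M L r k : ℝ) * ((k : ℝ) * ((M : ℝ) + L) - r * M) * f k =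
      ∑ k ∈ range r,
        (hyperCount M L r k : ℝ) * (((M : ℝ) - k) * ((r : ℝ) - k)) * (f (k + 1) - f k) := by
  have key : ∀ k : ℕ, (hyperCount M L r k : ℝ) * ((k : ℝ) * ((M : ℝ) + L) - r * M) * f k =
      (hyperCount M L r k : ℝ) * ((k : ℝ) * ((L : ℝ) - r + k)) * f k -
      (hyperCount M L r k : ℝ) * (((M : ℝ) - k) * ((r : ℝ) - k)) * f k := fun k => by ring
  rw [sum_congr rfl fun k _ => key k, sum_sub_distrib,
    sum_congr rfl fun k _ => mul_sub _ (f (k + 1)) (f k), sum_sub_distrib, sum_range_succ',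
    sum_range_succ (fun k =>
      (hyperCount M L r k : ℝ) * (((M : ℝ) - k) * ((r : ℝ) - k)) * f k)]
  have : ∀ k ∈ range r, (hyperCount M L r (k + 1) : ℝ) *
      (((k + 1 : ℕ) : ℝ) * ((L : ℝ) - r + ((k + 1 : ℕ) : ℝ))) * f (k + 1) =
      (hyperCount M L r k : ℝ) * (((M : ℝ) - k) * ((r : ℝ) - k)) * f (k + 1) := by
    intro k hk
    rw [← hyperCount_succ M L r k (mem_range.1 hk)]
    push_cast
    ring
  rw [sum_congr rfl this]
  simp

lemma sum_hyperCount_mul_sq_le (M L r : ℕ) :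
    ∑ k ∈ range (r + 1),
        (hyperCount M L r k : ℝ) * ((k : ℝ) * ((M : ℝ) + L) - r * M) ^ 2 ≤
      ((M : ℝ) + L) ^ 2 * r * ((M + L).choose r : ℝ) := by
  have h := sum_hyperCount_mul_sub_mean M L r (fun k => (k : ℝ) * ((M : ℝ) + L) - r * M)
  have e : ∀ k : ℕ, (hyperCount M L r k : ℝ) * ((k : ℝ) * ((M : ℝ) + L) - r * M) ^ 2 =
    (hyperCount M L r k : ℝ) * ((k : ℝ) * ((M : ℝ) + L) - r * M) *
      ((k : ℝ) * ((M : ℝ) + L) - r * M) := fun k => by ring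
  simp only [e]
  rw [h]
  calc _ ≤ ∑ k ∈ range r, (hyperCount M L r k : ℝ) * (((M : ℝ) + L) ^ 2 * r) := by
        refine sum_le_sum fun k hk => ?_
        have hk' : (k : ℝ) ≤ r := by exact_mod_cast (mem_range.1 hk).le
        rw [mul_assoc]
        rcases le_or_gt k M with hM | hM
        · have hM' : (k : ℝ) ≤ M := by exact_mod_cast hM
          refine mul_le_mul_of_nonneg_left ?_ (Nat.cast_nonneg _)
          have h1 : ((M : ℝ) - k) * (r - k) ≤ ((M : ℝ) + L) * r := by
            have h0 : (0 : ℝ) ≤ k := Nat.cast_nonneg k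
            have hL : (0 : ℝ) ≤ L := Nat.cast_nonneg L
            exact mul_le_mul (by linarith) (by linarith) (by linarith) (by positivity)
          push_cast
          calc _ = ((M : ℝ) - k) * (r - k) * ((M : ℝ) + L) := by ring
            _ ≤ ((M : ℝ) + L) * r * ((M : ℝ) + L) := by gcongr
            _ = _ := by ring
        · simp [hyperCount, Nat.choose_eq_zero_of_lt hM]
    _ ≤ ∑ k ∈ range (r + 1), (hyperCount M L r k : ℝ) * (((M : ℝ) + L) ^ 2 * r) :=
        sum_le_sum_of_subset_of_nonneg (range_mono (Nat.le_succ r))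
          fun _ _ _ => by positivity
    _ = _ := by rw [← sum_mul, sum_hyperCount]; ring

/-- Size-biasing both coordinates of a hypergeometric count. -/
lemma hyperCount_mul_sub_mul_sub (m l t k : ℕ) (hk : k ≤ t) :
    (hyperCount (m + 1) (l + 1) (t + 1) k : ℝ) *
        ((((m + 1 : ℕ) : ℝ) - k) * (((t + 1 : ℕ) : ℝ) - k)) =
      ((m : ℝ) + 1) * ((l : ℝ) + 1) * hyperCount m l t k := by
  obtain ⟨d, rfl⟩ := Nat.exists_eq_add_of_le hk
  have h1 : (((m + 1).choose k : ℕ) : ℝ) * (((m + 1 : ℕ) : ℝ) - k) =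
      ((m : ℝ) + 1) * m.choose k := by
    rw [← cast_choose_succ_mul]
    exact_mod_cast (Nat.add_one_mul_choose_eq m k).symm
  have h2 : (((l + 1).choose (d + 1) : ℕ) : ℝ) * ((d : ℝ) + 1) =
      ((l : ℝ) + 1) * l.choose d := by
    exact_mod_cast (Nat.add_one_mul_choose_eq l d).symm
  have e1 : k + d + 1 - k = d + 1 := by omega
  have e2 : k + d - k = d := by omega
  simp only [hyperCount, e1, e2]
  push_cast at h1 ⊢
  linear_combination ((l + 1).choose (d + 1) : ℝ) * ((d : ℝ) + 1) * h1 +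
    ((m : ℝ) + 1) * m.choose k * h2

lemma cast_choose_add_two (N t : ℕ) :
    (((N + 2).choose (t + 1) : ℕ) : ℝ) * (((t : ℝ) + 1) * ((N : ℝ) + 1 - t)) =
      ((N : ℝ) + 2) * ((N : ℝ) + 1) * N.choose t := by
  have h1 : (((N + 2).choose (t + 1) : ℕ) : ℝ) * ((t : ℝ) + 1) =
      ((N : ℝ) + 2) * (N + 1).choose t := by
    have := (Nat.add_one_mul_choose_eq (N + 1) t).symm
    have h : ((((N + 2).choose (t + 1) * (t + 1) : ℕ)) : ℝ) =
        (((N + 1 + 1) * (N + 1).choose t : ℕ) : ℝ) := by exact_mod_cast this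
    push_cast at h
    linear_combination h
  have h2 := cast_choose_succ_mul (N + 1) t
  have h3 : (((N + 1).choose (t + 1) : ℕ) : ℝ) * ((t : ℝ) + 1) = ((N : ℝ) + 1) * N.choose t := by
    exact_mod_cast (Nat.add_one_mul_choose_eq N t).symm
  push_cast at h2
  linear_combination ((N : ℝ) + 1 - t) * h1 - ((N : ℝ) + 2) * h2 + ((N : ℝ) + 2) * h3

lemma card_filter_card_inter (n : ℕ) (S0 : Finset (Fin n)) (s k : ℕ) (hk : k ≤ s) :
    ((powersetCard s (univ : Finset (Fin n))).filter (fun S => (S ∩ S0).card = k)).card =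
      S0.card.choose k * (n - S0.card).choose (s - k) := by
  have hc : n - S0.card = S0ᶜ.card := by simp [card_compl]
  rw [hc, ← card_powersetCard, ← card_powersetCard, ← card_product]
  have hsplit : ∀ A : Finset (Fin n), (A ∩ S0).card + (A ∩ S0ᶜ).card = A.card := by
    intro A
    rw [← sdiff_eq_inter_compl, add_comm, card_sdiff_add_card_inter]
  refine card_nbij' (fun A => (A ∩ S0, A ∩ S0ᶜ)) (fun p => p.1 ∪ p.2) ?_ ?_ ?_ ?_
  · intro A hA
    have := hsplit A
    simp only [coe_filter, mem_powersetCard, Set.mem_ofPred_eq] at hA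
    simp only [coe_product, Set.mem_prod, mem_coe, mem_powersetCard]
    exact ⟨⟨inter_subset_right, hA.2⟩, inter_subset_right, by omega⟩
  · rintro ⟨P, Q⟩ h
    simp only [coe_product, Set.mem_prod, mem_coe, mem_powersetCard] at h
    obtain ⟨⟨hP, hPc⟩, hQ, hQc⟩ := h
    have hd : Disjoint P Q := disjoint_of_subset_left hP
      (disjoint_of_subset_right hQ disjoint_compl_right)
    have e : (P ∪ Q) ∩ S0 = P := by
      ext x
      have h1 := @hP x
      have h2 := @hQ x
      simp only [mem_compl] at h2
      simp only [mem_inter, mem_union]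
      tauto
    simp only [coe_filter, mem_powersetCard, Set.mem_ofPred_eq, e, card_union_of_disjoint hd]
    exact ⟨⟨subset_univ _, by omega⟩, hPc⟩
  · intro A _
    ext x
    simp only [mem_union, mem_inter, mem_compl]
    tauto
  · rintro ⟨P, Q⟩ h
    simp only [coe_product, Set.mem_prod, mem_coe, mem_powersetCard] at h
    obtain ⟨⟨hP, hPc⟩, hQ, hQc⟩ := h
    simp only [Prod.mk.injEq]
    constructor <;>
    · ext x
      have h1 := @hP x
      have h2 := @hQ x
      simp only [mem_compl] at h2
      simp only [mem_inter, mem_union, mem_compl]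
      tauto

lemma abs_muFn_le (n : ℕ) (U : Finset (Fin n) → ℝ) (S0 : Finset (Fin n)) (s k : ℕ)
    (hk : k ≤ s) (B : ℝ) (hB : 0 ≤ B) (hU : ∀ S, |U S| ≤ B) : |muFn n U S0 s k| ≤ B := by
  rw [muFn, ← card_filter_card_inter n S0 s k hk, abs_div, Nat.abs_cast]
  refine div_le_of_le_mul₀ (Nat.cast_nonneg _) hB ?_
  refine (abs_sum_le_sum_abs _ _).trans ((sum_le_card_nsmul _ _ B fun S _ => hU S).trans ?_)
  rw [nsmul_eq_mul, mul_comm]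

/-- The permutations of `Fin n` that preserve `S0`. -/
def setStabilizer (n : ℕ) (S0 : Finset (Fin n)) : Finset (Equiv.Perm (Fin n)) :=
  univ.filter fun σ => ∀ x, σ x ∈ S0 ↔ x ∈ S0

lemma mem_setStabilizer {n : ℕ} {S0 : Finset (Fin n)} {σ : Equiv.Perm (Fin n)} :
    σ ∈ setStabilizer n S0 ↔ ∀ x, σ x ∈ S0 ↔ x ∈ S0 := by
  simp [setStabilizer]

lemma card_image_inter_of_mem_setStabilizer {n : ℕ} {S0 : Finset (Fin n)}
    {σ : Equiv.Perm (Fin n)} (hσ : σ ∈ setStabilizer n S0) (A : Finset (Fin n)) :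
    (A.image σ ∩ S0).card = (A ∩ S0).card := by
  rw [← card_image_of_injective (A ∩ S0) σ.injective, image_inter _ _ σ.injective]
  congr 2
  ext x
  rw [mem_setStabilizer] at hσ
  simp only [mem_image]
  constructor
  · intro hx
    exact ⟨σ.symm x, by rw [← hσ]; simpa using hx, by simp⟩
  · rintro ⟨y, hy, rfl⟩
    exact (hσ y).2 hy

/-- The stabilizer of `S0` acts transitively on the sets of given size and given intersection
size with `S0`. -/
lemma exists_setStabilizer_image_eq {n : ℕ} (S0 A A' : Finset (Fin n)) (h1 : A.card = A'.card)
    (h2 : (A ∩ S0).card = (A' ∩ S0).card) : ∃ σ ∈ setStabilizer n S0, A.image σ = A' := by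
  classical
  let f : Finset (Fin n) → Fin n → Bool × Bool := fun B x => (decide (x ∈ B), decide (x ∈ S0))
  have hcard : ∀ c, Nonempty ({a // f A a = c} ≃ {b // f A' b = c}) := by
    intro c
    refine ⟨Fintype.equivOfCardEq ?_⟩
    rw [Fintype.card_subtype, Fintype.card_subtype]
    have hs : ∀ B : Finset (Fin n), (B ∩ S0).card + (B \ S0).card = B.card := fun B => by
      rw [add_comm, card_sdiff_add_card_inter]
    have hs' : ∀ B : Finset (Fin n), (B ∩ S0).card + (S0 \ B).card = S0.card := fun B => by
      rw [add_comm, inter_comm, card_sdiff_add_card_inter]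
    have hu : ∀ B : Finset (Fin n), B.card + (S0 \ B).card + ((B ∪ S0)ᶜ).card = n := fun B => by
      rw [add_comm B.card, card_sdiff_add_card, union_comm, card_add_card_compl]
      simp
    have a1 := hs A
    have a2 := hs' A
    have a3 := hu A
    have b1 := hs A'
    have b2 := hs' A'
    have b3 := hu A'
    have e1 : ∀ B, univ.filter (fun x => f B x = (true, true)) = B ∩ S0 := fun B => by
      ext x; simp [f]
    have e2 : ∀ B, univ.filter (fun x => f B x = (true, false)) = B \ S0 := fun B => by
      ext x; simp [f]
    have e3 : ∀ B, univ.filter (fun x => f B x = (false, true)) = S0 \ B := fun B => by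
      ext x; simp [f, and_comm]
    have e4 : ∀ B, univ.filter (fun x => f B x = (false, false)) = (B ∪ S0)ᶜ := fun B => by
      ext x; simp [f]
    obtain ⟨p, q⟩ := c
    cases p <;> cases q
    · rw [e4, e4]; omega
    · rw [e3, e3]; omega
    · rw [e2, e2]; omega
    · rw [e1, e1]; omega
  have e := fun c => (hcard c).some
  have he : ∀ x, f A' (Equiv.ofFiberEquiv e x) = f A x := fun x => Equiv.ofFiberEquiv_map e x
  have heA : ∀ x, Equiv.ofFiberEquiv e x ∈ A' ↔ x ∈ A := fun x => by
    simpa [f] using congrArg Prod.fst (he x)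
  have heS : ∀ x, Equiv.ofFiberEquiv e x ∈ S0 ↔ x ∈ S0 := fun x => by
    simpa [f] using congrArg Prod.snd (he x)
  refine ⟨Equiv.ofFiberEquiv e, mem_setStabilizer.2 heS, ?_⟩
  ext y
  rw [mem_image]
  constructor
  · rintro ⟨x, hx, rfl⟩
    exact (heA x).2 hx
  · intro hy
    obtain ⟨x, rfl⟩ := (Equiv.ofFiberEquiv e).surjective y
    exact ⟨x, (heA x).1 hy, rfl⟩

lemma setStabilizer_card_pos (n : ℕ) (S0 : Finset (Fin n)) : 0 < (setStabilizer n S0).card :=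
  card_pos.2 ⟨1, mem_setStabilizer.2 fun x => by simp⟩

/-- `muFn` is the average of `U` over the orbit of any set of the right type. -/
lemma muFn_mul_card_setStabilizer (n : ℕ) (U : Finset (Fin n) → ℝ) (S0 A : Finset (Fin n)) :
    ((setStabilizer n S0).card : ℝ) * muFn n U S0 A.card (A ∩ S0).card =
      ∑ σ ∈ setStabilizer n S0, U (A.image σ) := by
  set s := A.card with hs
  set k := (A ∩ S0).card with hk
  set F := (powersetCard s (univ : Finset (Fin n))).filter (fun S => (S ∩ S0).card = k) with hF
  have hmem : ∀ B, B ∈ F ↔ B.card = s ∧ (B ∩ S0).card = k := fun B => by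
    simp [hF]
  have hAF : A ∈ F := (hmem A).2 ⟨rfl, rfl⟩
  have hinv : ∀ B ∈ F, ∑ σ ∈ setStabilizer n S0, U (B.image σ) =
      ∑ σ ∈ setStabilizer n S0, U (A.image σ) := by
    intro B hB
    obtain ⟨τ, hτ, rfl⟩ := exists_setStabilizer_image_eq S0 A B ((hmem B).1 hB).1.symm
      ((hmem B).1 hB).2.symm
    rw [mem_setStabilizer] at hτ
    refine sum_nbij' (fun σ => σ * τ) (fun σ => σ * τ⁻¹) ?_ ?_ ?_ ?_ ?_
    · intro σ hσ
      rw [mem_setStabilizer] at hσ ⊢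
      intro x
      rw [Equiv.Perm.mul_apply, hσ, hτ]
    · intro σ hσ
      rw [mem_setStabilizer] at hσ ⊢
      intro x
      rw [Equiv.Perm.mul_apply, hσ, ← hτ]
      simp
    · intro σ _
      simp
    · intro σ _
      simp
    · intro σ _
      rw [image_image]
      rfl
  have hperm : ∀ σ ∈ setStabilizer n S0, ∑ B ∈ F, U (B.image σ) = ∑ B ∈ F, U B := by
    intro σ hσ
    have hσ' : σ⁻¹ ∈ setStabilizer n S0 := by
      rw [mem_setStabilizer] at hσ ⊢
      intro x
      rw [← hσ]
      simp
    refine sum_nbij' (fun B => B.image σ) (fun B => B.image (σ⁻¹ : Equiv.Perm (Fin n)))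
      ?_ ?_ ?_ ?_ ?_
    · intro B hB
      rw [hmem] at hB ⊢
      rw [card_image_of_injective _ σ.injective, card_image_inter_of_mem_setStabilizer hσ]
      exact hB
    · intro B hB
      rw [hmem] at hB ⊢
      rw [card_image_of_injective _ (Equiv.injective _),
        card_image_inter_of_mem_setStabilizer hσ']
      exact hB
    · intro B _
      simp [image_image, Function.comp_def]
    · intro B _
      simp [image_image, Function.comp_def]
    · intro B _
      rfl
  have hcount : (F.card : ℝ) * ∑ σ ∈ setStabilizer n S0, U (A.image σ) =
      ((setStabilizer n S0).card : ℝ) * ∑ B ∈ F, U B := by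
    rw [← nsmul_eq_mul, ← nsmul_eq_mul, ← sum_const, ← sum_const, ← sum_congr rfl hinv,
      ← sum_congr rfl hperm, sum_comm]
  have hFpos : (0 : ℝ) < F.card := by exact_mod_cast card_pos.2 ⟨A, hAF⟩
  have hmu : muFn n U S0 s k = (∑ B ∈ F, U B) / F.card := by
    rw [muFn, ← card_filter_card_inter n S0 s k (card_le_card inter_subset_left)]
  rw [hmu, mul_div_assoc', ← hcount]
  field_simp

lemma exists_two_notMem_of_card_le {n : ℕ} (P : Finset (Fin n)) (k : ℕ) (h : k + 2 ≤ P.card) :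
    ∃ Q ⊆ P, Q.card = k ∧ ∃ x ∈ P, ∃ y ∈ P, x ∉ Q ∧ y ∉ Q ∧ x ≠ y := by
  obtain ⟨Q, hQ, hc⟩ := exists_subset_card_eq (show k ≤ P.card by omega)
  have : 1 < (P \ Q).card := by rw [card_sdiff_of_subset hQ]; omega
  obtain ⟨x, hx, y, hy, hxy⟩ := one_lt_card.1 this
  rw [mem_sdiff] at hx hy
  exact ⟨Q, hQ, hc, x, hx.1, y, hy.1, hx.2, hy.2, hxy⟩

lemma abs_second_difference_muFn_le {n : ℕ} {U : Finset (Fin n) → ℝ} {C υ : ℝ}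
    (hU : SecondOrderStable n U C υ) (S0 : Finset (Fin n)) (r k : ℕ) (hr : 1 ≤ r) (hkr : k ≤ r)
    (hk : k + 2 ≤ S0.card) (hk' : (r - k) + 2 ≤ n - S0.card) :
    |(muFn n U S0 (r + 2) (k + 2) - muFn n U S0 (r + 2) (k + 1)) -
        (muFn n U S0 (r + 2) (k + 1) - muFn n U S0 (r + 2) k)| ≤
      C * (r : ℝ) ^ (-(3 / 2 + υ) : ℝ) := by
  have hc : S0ᶜ.card = n - S0.card := by simp [card_compl]
  obtain ⟨P, hP, hPc, a, ha, a', ha', haP, ha'P, haa'⟩ := exists_two_notMem_of_card_le S0 k hk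
  obtain ⟨Q, hQ, hQc, b, hb, b', hb', hbQ, hb'Q, hbb'⟩ :=
    exists_two_notMem_of_card_le S0ᶜ (r - k) (by omega)
  have hbP : b ∉ P := fun h => (mem_compl.1 hb) (hP h)
  have hb'P : b' ∉ P := fun h => (mem_compl.1 hb') (hP h)
  have haQ : a ∉ Q := fun h => (mem_compl.1 (hQ h)) ha
  have ha'Q : a' ∉ Q := fun h => (mem_compl.1 (hQ h)) ha'
  have hab : a ≠ b := fun h => mem_compl.1 hb (h ▸ ha)
  have hab' : a ≠ b' := fun h => mem_compl.1 hb' (h ▸ ha)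
  have ha'b : a' ≠ b := fun h => mem_compl.1 hb (h ▸ ha')
  have ha'b' : a' ≠ b' := fun h => mem_compl.1 hb' (h ▸ ha')
  have hd : Disjoint P Q := disjoint_of_subset_left hP
    (disjoint_of_subset_right hQ disjoint_compl_right)
  set S := P ∪ Q with hS
  have hScard : S.card = r := by rw [hS, card_union_of_disjoint hd]; omega
  have haS : a ∉ S := by simp [hS, haP, haQ]
  have ha'S : a' ∉ S := by simp [hS, ha'P, ha'Q]
  have hbS : b ∉ S := by simp [hS, hbP, hbQ]
  have hb'S : b' ∉ S := by simp [hS, hb'P, hb'Q]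
  have hSS0 : S ∩ S0 = P := by
    ext x
    have h1 := @hP x
    have h2 := @hQ x
    simp only [mem_compl] at h2
    simp only [hS, mem_inter, mem_union]
    tauto
  rw [mem_compl] at hb hb'
  have hcard : ∀ x y, x ∉ S → y ∉ S → x ≠ y → (S ∪ {x, y}).card = r + 2 := by
    intro x y hx hy hxy
    rw [card_union_of_disjoint (by simp [hx, hy]), card_pair hxy, hScard]
  have hk2 : ((S ∪ {a, a'}) ∩ S0).card = k + 2 := by
    have : (S ∪ {a, a'}) ∩ S0 = insert a (insert a' P) := by
      rw [union_inter_distrib_right, hSS0]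
      ext x
      simp only [mem_union, mem_inter, mem_insert, mem_singleton]
      constructor
      · tauto
      · rintro (rfl | rfl | h) <;> tauto
    rw [this, card_insert_of_notMem (by simp [haa', haP]), card_insert_of_notMem ha'P, hPc]
  have hone : ∀ x y, x ∈ S0 → y ∉ S0 → x ∉ P → ((S ∪ {x, y}) ∩ S0).card = k + 1 := by
    intro x y hx hy hxP
    have : (S ∪ {x, y}) ∩ S0 = insert x P := by
      rw [union_inter_distrib_right, hSS0]
      ext z
      simp only [mem_union, mem_inter, mem_insert, mem_singleton]
      constructor
      · rintro (h | ⟨rfl | rfl, h⟩) <;> tauto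
      · rintro (rfl | h) <;> tauto
    rw [this, card_insert_of_notMem hxP, hPc]
  have hk0 : ((S ∪ {b, b'}) ∩ S0).card = k := by
    have : (S ∪ {b, b'}) ∩ S0 = P := by
      rw [union_inter_distrib_right, hSS0]
      ext z
      simp only [mem_union, mem_inter, mem_insert, mem_singleton]
      constructor
      · rintro (h | ⟨rfl | rfl, h⟩) <;> tauto
      · tauto
    rw [this, hPc]
  have m2 := muFn_mul_card_setStabilizer n U S0 (S ∪ {a, a'})
  have m1 := muFn_mul_card_setStabilizer n U S0 (S ∪ {a, b})
  have m1' := muFn_mul_card_setStabilizer n U S0 (S ∪ {a', b'})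
  have m0 := muFn_mul_card_setStabilizer n U S0 (S ∪ {b, b'})
  rw [hcard _ _ haS ha'S haa', hk2] at m2
  rw [hcard _ _ haS hbS hab, hone _ _ ha hb haP] at m1
  rw [hcard _ _ ha'S hb'S ha'b', hone _ _ ha' hb' ha'P] at m1'
  rw [hcard _ _ hbS hb'S hbb', hk0] at m0
  have hG : (0 : ℝ) < (setStabilizer n S0).card := by exact_mod_cast setStabilizer_card_pos n S0
  refine le_of_mul_le_mul_left ?_ hG
  calc _ = |((setStabilizer n S0).card : ℝ) * ((muFn n U S0 (r + 2) (k + 2) -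
        muFn n U S0 (r + 2) (k + 1)) -
        (muFn n U S0 (r + 2) (k + 1) - muFn n U S0 (r + 2) k))| := by
        rw [abs_mul, Nat.abs_cast]
    _ = |∑ σ ∈ setStabilizer n S0, (U ((S ∪ {a, a'}).image σ) - U ((S ∪ {a, b}).image σ) -
          U ((S ∪ {a', b'}).image σ) + U ((S ∪ {b, b'}).image σ))| := by
        rw [sum_add_distrib, sum_sub_distrib, sum_sub_distrib, ← m2, ← m1, ← m1', ← m0]
        congr 1
        ring
    _ ≤ ∑ σ ∈ setStabilizer n S0, C * (r : ℝ) ^ (-(3 / 2 + υ) : ℝ) := by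
        refine (abs_sum_le_sum_abs _ _).trans (sum_le_sum fun σ _ => ?_)
        have hm : ∀ x, x ∉ S → σ x ∉ S.image σ := fun x hx => by simpa using hx
        have hσS : (S.image σ).card = r := by
          rw [card_image_of_injective _ σ.injective, hScard]
        have := hU (S.image σ) (by omega) (σ a) (σ a') (σ b) (σ b') (hm _ haS) (hm _ ha'S)
          (hm _ hbS) (hm _ hb'S) (by simpa using haa') (by simpa using hab)
          (by simpa using hab') (by simpa using ha'b) (by simpa using ha'b') (by simpa using hbb')
        rw [hσS] at this
        simpa only [image_union, image_insert, image_singleton] using this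
    _ = _ := by rw [sum_const, nsmul_eq_mul]

lemma abs_sub_le_mul_of_step {f : ℕ → ℝ} {B : ℝ} {a b : ℕ}
    (h : ∀ i, a ≤ i → i + 1 ≤ b → |f (i + 1) - f i| ≤ B) {i j : ℕ} (hi : a ≤ i) (hib : i ≤ b)
    (hj : a ≤ j) (hjb : j ≤ b) : |f i - f j| ≤ B * |(i : ℝ) - j| := by
  have key : ∀ i j, a ≤ i → i ≤ j → j ≤ b → |f j - f i| ≤ B * ((j : ℝ) - i) := by
    intro i j hi hij
    induction j, hij using Nat.le_induction with
    | base => simp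
    | succ j hij ih =>
      intro hjb
      have h1 := ih (by omega)
      have h2 := h j (by omega) hjb
      have h3 := abs_add_le (f (j + 1) - f j) (f j - f i)
      rw [sub_add_sub_cancel] at h3
      push_cast
      linarith
  rcases le_total i j with hij | hij
  · rw [abs_sub_comm, abs_sub_comm (i : ℝ), abs_of_nonneg (a := (j : ℝ) - i)]
    · exact key i j hi hij hjb
    · have : (i : ℝ) ≤ j := by exact_mod_cast hij
      linarith
  · rw [abs_of_nonneg (a := (i : ℝ) - j)]
    · exact key j i hj hij hib
    · have : (j : ℝ) ≤ i := by exact_mod_cast hij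
      linarith

/-- `Tfn` as a hypergeometric average of the discrete derivative of `muFn`. -/
lemma Tfn_mul_choose (m l t : ℕ) (ht : t ≤ m + l) (U : Finset (Fin (m + l + 2)) → ℝ)
    (S0 : Finset (Fin (m + l + 2))) (hS0 : S0.card = m + 1) :
    Tfn (m + l + 2) U S0 (t + 1) * ((m + l).choose t : ℝ) =
      ((m : ℝ) + 1) * ((l : ℝ) + 1) / (((m : ℝ) + l + 2) * ((m : ℝ) + l + 1)) *
        ∑ k ∈ range (t + 1), (hyperCount m l t k : ℝ) *
          (muFn (m + l + 2) U S0 (t + 1) (k + 1) - muFn (m + l + 2) U S0 (t + 1) k) := by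
  set μ := muFn (m + l + 2) U S0 (t + 1) with hμ
  have hstein := sum_hyperCount_mul_sub_mean (m + 1) (l + 1) (t + 1) μ
  have hbias : ∀ k ∈ range (t + 1), (hyperCount (m + 1) (l + 1) (t + 1) k : ℝ) *
      ((((m + 1 : ℕ) : ℝ) - k) * (((t + 1 : ℕ) : ℝ) - k)) * (μ (k + 1) - μ k) =
      ((m : ℝ) + 1) * ((l : ℝ) + 1) * (hyperCount m l t k * (μ (k + 1) - μ k)) := by
    intro k hk
    rw [hyperCount_mul_sub_mul_sub m l t k (by simpa [Nat.lt_succ_iff] using hk)]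
    ring
  rw [sum_congr rfl hbias, ← mul_sum] at hstein
  have hsum : Tfn (m + l + 2) U S0 (t + 1) = ∑ k ∈ range (t + 1 + 1),
      (hyperCount (m + 1) (l + 1) (t + 1) k : ℝ) / ((m + l + 2).choose (t + 1) : ℝ) *
      (((m + l + 2 : ℕ) : ℝ) / (((t + 1 : ℕ) : ℝ) *
        (((m + l + 2 : ℕ) : ℝ) - ((t + 1 : ℕ) : ℝ)))) *
      ((k : ℝ) - ((t + 1 : ℕ) : ℝ) * ((m + 1 : ℕ) : ℝ) / ((m + l + 2 : ℕ) : ℝ)) * μ k := by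
    have hl : m + l + 2 - (m + 1) = l + 1 := by omega
    rw [Tfn, hS0, hl]
    refine sum_subset ?_ ?_
    · intro k hk
      rw [mem_Icc] at hk
      rw [mem_range]
      omega
    · intro k hk hk'
      rw [mem_range] at hk
      rw [mem_Icc] at hk'
      have : hyperCount (m + 1) (l + 1) (t + 1) k = 0 := by
        rw [hyperCount, Nat.mul_eq_zero, Nat.choose_eq_zero_iff, Nat.choose_eq_zero_iff]
        omega
      rw [hyperCount] at this
      rw [this]
      simp
  have hch := cast_choose_add_two (m + l) t
  have hcpos : (0 : ℝ) < ((m + l + 2).choose (t + 1) : ℝ) := by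
    exact_mod_cast Nat.choose_pos (by omega)
  have hcpos' : (0 : ℝ) < ((m + l).choose t : ℝ) := by
    exact_mod_cast Nat.choose_pos ht
  have htR : (t : ℝ) ≤ m + l := by exact_mod_cast ht
  have hne : ((m : ℝ) + l + 1 - t) ≠ 0 := by linarith
  have hT : Tfn (m + l + 2) U S0 (t + 1) =
      1 / (((m + l + 2).choose (t + 1) : ℝ) * (((t : ℝ) + 1) * ((m : ℝ) + l + 1 - t))) *
      ∑ k ∈ range (t + 1 + 1), (hyperCount (m + 1) (l + 1) (t + 1) k : ℝ) *
        ((k : ℝ) * (((m + 1 : ℕ) : ℝ) + ((l + 1 : ℕ) : ℝ)) -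
          ((t + 1 : ℕ) : ℝ) * ((m + 1 : ℕ) : ℝ)) * μ k := by
    rw [hsum, mul_sum]
    refine sum_congr rfl fun k _ => ?_
    have e : ((m + l + 2 : ℕ) : ℝ) - ((t + 1 : ℕ) : ℝ) = (m : ℝ) + l + 1 - t := by
      push_cast; ring
    rw [e]
    push_cast
    field_simp
    ring
  push_cast at hch
  rw [hT, hstein, hch]
  field_simp

lemma abs_sub_floor_le_one (m l t : ℕ) (ht : t ≤ m + l) (hN : 0 < m + l) :
    |(t : ℝ) * m / ((m : ℝ) + l) - (((t + 1) * (m + 1) / (m + l + 2) : ℕ) : ℝ)| ≤ 1 := by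
  set j := (t + 1) * (m + 1) / (m + l + 2) with hj
  have hj1 : j * (m + l + 2) ≤ (t + 1) * (m + 1) := Nat.div_mul_le_self _ _
  have hj2 : (t + 1) * (m + 1) < (j + 1) * (m + l + 2) := by
    rw [mul_comm (j + 1)]
    exact Nat.lt_mul_div_succ _ (by omega)
  have h1 : (j : ℝ) * ((m : ℝ) + l + 2) ≤ ((t : ℝ) + 1) * (m + 1) := by exact_mod_cast hj1
  have h2 : ((t : ℝ) + 1) * (m + 1) ≤ ((j : ℝ) + 1) * ((m : ℝ) + l + 2) := by
    exact_mod_cast hj2.le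
  have hNR : (0 : ℝ) < (m : ℝ) + l := by exact_mod_cast hN
  have htR : (t : ℝ) ≤ (m : ℝ) + l := by exact_mod_cast ht
  have hm : (0 : ℝ) ≤ m := Nat.cast_nonneg m
  have hl : (0 : ℝ) ≤ l := Nat.cast_nonneg l
  have ht0 : (0 : ℝ) ≤ t := Nat.cast_nonneg t
  set x := (t : ℝ) * m / ((m : ℝ) + l) with hx
  have hxN : x * ((m : ℝ) + l) = t * m := by rw [hx]; field_simp
  have hx0 : 0 ≤ x := by positivity
  have hxm : x ≤ m := by rw [hx, div_le_iff₀ hNR]; nlinarith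
  have hxt : x ≤ t := by rw [hx, div_le_iff₀ hNR]; nlinarith
  have hy : x * ((m : ℝ) + l + 2) ≤ ((t : ℝ) + 1) * (m + 1) := by nlinarith
  have hlow : (t : ℝ) + m ≤ (m + l) + x := by
    have : 0 ≤ ((m : ℝ) + l - t) * l := mul_nonneg (by linarith) hl
    have h3 : ((t : ℝ) - l) * ((m : ℝ) + l) ≤ t * m := by nlinarith
    have h4 : (t : ℝ) - l ≤ x := by rw [hx, le_div_iff₀ hNR]; exact h3
    linarith
  have hy' : ((t : ℝ) + 1) * (m + 1) ≤ (x + 1) * ((m : ℝ) + l + 2) := by nlinarith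
  have hP : (0 : ℝ) < (m : ℝ) + l + 2 := by linarith
  have g1 : (j : ℝ) ≤ x + 1 := le_of_mul_le_mul_right (h1.trans hy') hP
  have g2 : x ≤ (j : ℝ) + 1 := le_of_mul_le_mul_right (hy.trans h2) hP
  rw [abs_le]
  constructor <;> linarith

lemma sum_hyperCount_mul_abs_sub_le (m l t : ℕ) (ht : t ≤ m + l) (hN : 0 < m + l) :
    ∑ k ∈ range (t + 1), (hyperCount m l t k : ℝ) *
        |(k : ℝ) - (((t + 1) * (m + 1) / (m + l + 2) : ℕ) : ℝ)| ≤
      2 * √((t : ℝ) + 1) * ((m + l).choose t : ℝ) := by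
  have hj := abs_sub_floor_le_one m l t ht hN
  set j : ℝ := (((t + 1) * (m + 1) / (m + l + 2) : ℕ) : ℝ)
  set x := (t : ℝ) * m / ((m : ℝ) + l) with hx
  have hNR : (0 : ℝ) < (m : ℝ) + l := by exact_mod_cast hN
  set q := √((t : ℝ) + 1) with hq
  have hq2 : q ^ 2 = (t : ℝ) + 1 := Real.sq_sqrt (by positivity)
  have hq1 : 1 ≤ q := by
    rw [hq, Real.one_le_sqrt]
    have : (0 : ℝ) ≤ t := Nat.cast_nonneg t
    linarith
  have hvar : ∑ k ∈ range (t + 1), (hyperCount m l t k : ℝ) * ((k : ℝ) - x) ^ 2 ≤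
      t * ((m + l).choose t : ℝ) := by
    have h := sum_hyperCount_mul_sq_le m l t
    have e : ∀ k : ℕ, (hyperCount m l t k : ℝ) * ((k : ℝ) * ((m : ℝ) + l) - t * m) ^ 2 =
        ((m : ℝ) + l) ^ 2 * ((hyperCount m l t k : ℝ) * ((k : ℝ) - x) ^ 2) := by
      intro k
      rw [hx]
      field_simp
    simp only [e] at h
    rw [← mul_sum, mul_assoc] at h
    exact le_of_mul_le_mul_left h (by positivity)
  have hpt : ∀ k : ℕ, |(k : ℝ) - j| ≤ 1 + q / 2 + 1 / (2 * q) * ((k : ℝ) - x) ^ 2 := by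
    intro k
    have h1 := abs_sub_le (k : ℝ) x j
    have h2 : |(k : ℝ) - x| ≤ q / 2 + 1 / (2 * q) * ((k : ℝ) - x) ^ 2 := by
      rw [← sq_abs]
      have : q / 2 + 1 / (2 * q) * |(k : ℝ) - x| ^ 2 - |(k : ℝ) - x| =
          (q - |(k : ℝ) - x|) ^ 2 / (2 * q) := by
        field_simp
        ring
      have h3 : 0 ≤ (q - |(k : ℝ) - x|) ^ 2 / (2 * q) := by positivity
      linarith
    linarith
  calc _ ≤ ∑ k ∈ range (t + 1), ((1 + q / 2) * (hyperCount m l t k : ℝ) +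
        1 / (2 * q) * ((hyperCount m l t k : ℝ) * ((k : ℝ) - x) ^ 2)) := by
        refine sum_le_sum fun k _ => ?_
        have := mul_le_mul_of_nonneg_left (hpt k) (Nat.cast_nonneg (α := ℝ) (hyperCount m l t k))
        linarith
    _ ≤ (1 + q / 2) * ((m + l).choose t : ℝ) + 1 / (2 * q) * (t * ((m + l).choose t : ℝ)) := by
        rw [sum_add_distrib, ← mul_sum, ← mul_sum, sum_hyperCount]
        gcongr
    _ = (1 + q / 2 + t / (2 * q)) * ((m + l).choose t : ℝ) := by ring
    _ ≤ _ := by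
        gcongr
        have : (t : ℝ) / (2 * q) ≤ q / 2 := by
          rw [div_le_iff₀ (by positivity)]
          nlinarith
        linarith

/-- The discrete derivative of `muFn` is Lipschitz on the support of the hypergeometric weights. -/
lemma abs_sub_difference_muFn_le {m l r : ℕ} (hr : 1 ≤ r)
    {U : Finset (Fin (m + l + 2)) → ℝ} {C υ : ℝ} (hU : SecondOrderStable (m + l + 2) U C υ)
    (S0 : Finset (Fin (m + l + 2))) (hS0 : S0.card = m + 1) {i j : ℕ}
    (hi : i ≤ m) (hir : i ≤ r + 1) (hil : r + 1 ≤ l + i)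
    (hj : j ≤ m) (hjr : j ≤ r + 1) (hjl : r + 1 ≤ l + j) :
    |(muFn (m + l + 2) U S0 (r + 2) (i + 1) - muFn (m + l + 2) U S0 (r + 2) i) -
        (muFn (m + l + 2) U S0 (r + 2) (j + 1) - muFn (m + l + 2) U S0 (r + 2) j)| ≤
      C * (r : ℝ) ^ (-(3 / 2 + υ) : ℝ) * |(i : ℝ) - j| := by
  refine abs_sub_le_mul_of_step (f := fun i => muFn (m + l + 2) U S0 (r + 2) (i + 1) -
    muFn (m + l + 2) U S0 (r + 2) i) (a := r + 1 - l) (b := min m (r + 1)) ?_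
    (by omega) (by omega) (by omega) (by omega)
  intro k hk hk'
  exact abs_second_difference_muFn_le hU S0 r k hr (by omega) (by omega) (by omega)

lemma rpow_neg_le_mul_rpow_neg (r : ℕ) (hr : 1 ≤ r) (p : ℝ) (hp : 0 ≤ p) :
    (r : ℝ) ^ (-p) ≤ 3 ^ p * ((r : ℝ) + 2) ^ (-p) := by
  have hr' : (1 : ℝ) ≤ r := by exact_mod_cast hr
  have h3 : (3 : ℝ) ^ p = (1 / 3 : ℝ) ^ (-p) := by
    rw [one_div, Real.inv_rpow (by norm_num), Real.rpow_neg (by norm_num), inv_inv]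
  rw [h3, ← Real.mul_rpow (by norm_num) (by positivity)]
  exact Real.rpow_le_rpow_of_nonpos (by positivity) (by linarith) (by linarith)

/-- The hypergeometric average of the discrete derivative of `muFn` is close to its value near
the mean. -/
lemma abs_sum_hyperCount_mul_sub_le {m l t : ℕ} (ht : t ≤ m + l)
    {U : Finset (Fin (m + l + 2)) → ℝ} {Cb C υ : ℝ} (hCb : 0 ≤ Cb) (hC : 0 ≤ C) (hυ : 0 ≤ υ)
    (hb : ∀ S, |U S| ≤ Cb) (hU : SecondOrderStable (m + l + 2) U C υ)
    (S0 : Finset (Fin (m + l + 2))) (hS0 : S0.card = m + 1) (j : ℕ)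
    (hj : j = (t + 1) * (m + 1) / (m + l + 2)) :
    |∑ k ∈ range (t + 1), (hyperCount m l t k : ℝ) *
        ((muFn (m + l + 2) U S0 (t + 1) (k + 1) - muFn (m + l + 2) U S0 (t + 1) k) -
        (muFn (m + l + 2) U S0 (t + 1) (j + 1) - muFn (m + l + 2) U S0 (t + 1) j))| ≤
      (4 * Cb * 2 ^ (1 + υ) + 2 * C * 3 ^ (3 / 2 + υ)) * ((t : ℝ) + 1) ^ (-(1 + υ)) *
        ((m + l).choose t : ℝ) := by
  have hj1 : j * (m + l + 2) ≤ (t + 1) * (m + 1) := hj ▸ Nat.div_mul_le_self _ _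
  have hj2 : (t + 1) * (m + 1) < (j + 1) * (m + l + 2) := by
    rw [hj, mul_comm (_ / _ + 1)]
    exact Nat.lt_mul_div_succ _ (by omega)
  have hjt : j ≤ t := by
    by_contra! h
    have : (t + 1) * (m + l + 2) ≤ j * (m + l + 2) := by gcongr; omega
    nlinarith
  have hjm : j ≤ m := by
    by_contra! h
    have : (m + 1) * (m + l + 2) ≤ j * (m + l + 2) := by gcongr; omega
    nlinarith
  have hjl : t ≤ l + j := by
    by_contra! h
    obtain ⟨d, rfl⟩ : ∃ d, t = l + j + 1 + d := ⟨t - (l + j + 1), by omega⟩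
    obtain ⟨c, rfl⟩ : ∃ c, m = j + 1 + d + c := ⟨m - (j + 1 + d), by omega⟩
    nlinarith
  have hpos : (0 : ℝ) < (t : ℝ) + 1 := by positivity
  refine (abs_sum_le_sum_abs _ _).trans ?_
  simp only [abs_mul, Nat.abs_cast]
  rcases le_or_gt t 1 with h1 | h1
  · have hμ : ∀ k ≤ t + 1, |muFn (m + l + 2) U S0 (t + 1) k| ≤ Cb := fun k hk =>
      abs_muFn_le _ U S0 _ k hk Cb hCb hb
    have hbd : (4 * Cb : ℝ) ≤
        (4 * Cb * 2 ^ (1 + υ) + 2 * C * 3 ^ (3 / 2 + υ)) * ((t : ℝ) + 1) ^ (-(1 + υ)) := by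
      have h2 : (1 : ℝ) ≤ 2 ^ (1 + υ) * ((t : ℝ) + 1) ^ (-(1 + υ)) := by
        have : (2 : ℝ) ^ (-(1 + υ)) ≤ ((t : ℝ) + 1) ^ (-(1 + υ)) := by
          refine Real.rpow_le_rpow_of_nonpos hpos ?_ (by linarith)
          have : (t : ℝ) ≤ 1 := by exact_mod_cast h1
          linarith
        calc (1 : ℝ) = 2 ^ (1 + υ) * 2 ^ (-(1 + υ)) := by
              rw [← Real.rpow_add (by norm_num)]; simp
          _ ≤ _ := by gcongr
      have h3 : 0 ≤ 2 * C * 3 ^ (3 / 2 + υ) * ((t : ℝ) + 1) ^ (-(1 + υ)) := by positivity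
      nlinarith
    rw [← sum_hyperCount, mul_sum]
    refine sum_le_sum fun k hk => ?_
    rw [mul_comm]
    refine mul_le_mul_of_nonneg_right (le_trans ?_ hbd) (Nat.cast_nonneg _)
    rw [mem_range] at hk
    have a1 := abs_le.1 (hμ k (by omega))
    have a2 := abs_le.1 (hμ (k + 1) (by omega))
    have a3 := abs_le.1 (hμ j (by omega))
    have a4 := abs_le.1 (hμ (j + 1) (by omega))
    rw [abs_le]
    constructor <;> linarith [a1.1, a1.2, a2.1, a2.2, a3.1, a3.2, a4.1, a4.2]
  · obtain ⟨r, rfl⟩ : ∃ r, t = r + 1 := ⟨t - 1, by omega⟩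
    have hr : 1 ≤ r := by omega
    set B := C * (r : ℝ) ^ (-(3 / 2 + υ) : ℝ) with hB
    have hB0 : 0 ≤ B := by positivity
    have hmad := sum_hyperCount_mul_abs_sub_le m l (r + 1) ht (by omega)
    rw [← hj] at hmad
    calc _ ≤ ∑ k ∈ range (r + 1 + 1), B * ((hyperCount m l (r + 1) k : ℝ) * |(k : ℝ) - j|) := by
          refine sum_le_sum fun k hk => ?_
          rw [mem_range] at hk
          by_cases hk0 : hyperCount m l (r + 1) k = 0
          · simp [hk0]
          · rw [hyperCount, Nat.mul_eq_zero, Nat.choose_eq_zero_iff, Nat.choose_eq_zero_iff] at hk0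
            have := abs_sub_difference_muFn_le hr hU S0 hS0 (i := k) (j := j) (by omega)
              (by omega) (by omega) hjm hjt hjl
            calc _ ≤ (hyperCount m l (r + 1) k : ℝ) * (B * |(k : ℝ) - j|) :=
                  mul_le_mul_of_nonneg_left this (Nat.cast_nonneg _)
              _ = _ := by ring
      _ ≤ B * (2 * √(((r + 1 : ℕ) : ℝ) + 1) * ((m + l).choose (r + 1) : ℝ)) := by
          rw [← mul_sum]
          gcongr
      _ ≤ _ := by
          rw [← mul_assoc]
          refine mul_le_mul_of_nonneg_right ?_ (Nat.cast_nonneg _)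
          have e : ((r + 1 : ℕ) : ℝ) + 1 = (r : ℝ) + 2 := by push_cast; ring
          rw [e]
          have hsplit : ((r : ℝ) + 2) ^ (-(3 / 2 + υ)) * √((r : ℝ) + 2) =
              ((r : ℝ) + 2) ^ (-(1 + υ)) := by
            rw [Real.sqrt_eq_rpow, ← Real.rpow_add (by positivity)]
            congr 1
            ring
          calc B * (2 * √((r : ℝ) + 2)) ≤
                C * (3 ^ (3 / 2 + υ) * ((r : ℝ) + 2) ^ (-(3 / 2 + υ))) * (2 * √((r : ℝ) + 2)) := by
                rw [hB]
                gcongr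
                exact rpow_neg_le_mul_rpow_neg r hr _ (by linarith)
            _ = 2 * C * 3 ^ (3 / 2 + υ) * (((r : ℝ) + 2) ^ (-(3 / 2 + υ)) * √((r : ℝ) + 2)) := by
                ring
            _ ≤ _ := by
                rw [hsplit]
                gcongr
                have : 0 ≤ 4 * Cb * 2 ^ (1 + υ) := by positivity
                linarith

/-- Approximation of `T(s)` by a single discrete derivative of `μ` evaluated at
`s1* = ⌊s·s0/n⌋`, with error `O(s^{−(1+υ)})` uniformly in `s`. -/
theorem T_approximation (Cb C υ : ℝ) (hCb : 0 < Cb) (hC : 0 < C) (hυ : 0 < υ) :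
    ∃ C'' : ℝ, ∀ (n : ℕ) (U : Finset (Fin n) → ℝ) (S0 : Finset (Fin n)),
      (∀ S : Finset (Fin n), |U S| ≤ Cb) →
      SecondOrderStable n U C υ →
      1 ≤ S0.card → S0.card ≤ n - 1 →
      ∀ s : ℕ, 1 ≤ s → s ≤ n - 1 →
        |Tfn n U S0 s -
            (n : ℝ) / ((n : ℝ) - 1) * ((S0.card : ℝ) / n) * (1 - (S0.card : ℝ) / n) *
              (muFn n U S0 s (s * S0.card / n + 1) - muFn n U S0 s (s * S0.card / n))| ≤
          C'' * ((n : ℝ) / ((n : ℝ) - 1)) * ((S0.card : ℝ) / n) * (1 - (S0.card : ℝ) / n) *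
            (s : ℝ) ^ (-(1 + υ) : ℝ) := by
  refine ⟨4 * Cb * 2 ^ (1 + υ) + 2 * C * 3 ^ (3 / 2 + υ), ?_⟩
  intro n U S0 hb hU h1 h2 s hs hs'
  obtain ⟨m, hm⟩ : ∃ m, S0.card = m + 1 := ⟨S0.card - 1, by omega⟩
  obtain ⟨l, rfl⟩ : ∃ l, n = m + l + 2 := ⟨n - (m + 2), by omega⟩
  obtain ⟨t, rfl⟩ : ∃ t, s = t + 1 := ⟨s - 1, by omega⟩
  have ht : t ≤ m + l := by omega
  have hT := Tfn_mul_choose m l t ht U S0 hm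
  have hmain := abs_sum_hyperCount_mul_sub_le ht hCb.le hC.le hυ.le hb hU S0 hm _ rfl
  rw [hm]
  set D := muFn (m + l + 2) U S0 (t + 1) ((t + 1) * (m + 1) / (m + l + 2) + 1) -
    muFn (m + l + 2) U S0 (t + 1) ((t + 1) * (m + 1) / (m + l + 2))
  set C'' := 4 * Cb * 2 ^ (1 + υ) + 2 * C * 3 ^ (3 / 2 + υ)
  have hcpos : (0 : ℝ) < ((m + l).choose t : ℝ) := by exact_mod_cast Nat.choose_pos ht
  set A := ((m : ℝ) + 1) * ((l : ℝ) + 1) / (((m : ℝ) + l + 2) * ((m : ℝ) + l + 1)) with hA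
  have hA0 : 0 ≤ A := by positivity
  have hA' : ((m + l + 2 : ℕ) : ℝ) / (((m + l + 2 : ℕ) : ℝ) - 1) *
      (((m + 1 : ℕ) : ℝ) / ((m + l + 2 : ℕ) : ℝ)) *
      (1 - ((m + 1 : ℕ) : ℝ) / ((m + l + 2 : ℕ) : ℝ)) = A := by
    have e : ((m + l + 2 : ℕ) : ℝ) - 1 = (m : ℝ) + l + 1 := by push_cast; ring
    rw [e, hA]
    push_cast
    field_simp
    ring
  rw [sum_congr rfl fun k _ => mul_sub _ _ D, sum_sub_distrib, ← sum_mul, sum_hyperCount] at hmain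
  rw [mul_assoc C'', mul_assoc C'', hA']
  refine le_of_mul_le_mul_right ?_ hcpos
  calc _ = |Tfn (m + l + 2) U S0 (t + 1) * ((m + l).choose t : ℝ) -
        A * (((m + l).choose t : ℝ) * D)| := by
        rw [← abs_of_pos hcpos, ← abs_mul, abs_of_pos hcpos]
        congr 1
        ring
    _ = A * |∑ k ∈ range (t + 1), (hyperCount m l t k : ℝ) *
        (muFn (m + l + 2) U S0 (t + 1) (k + 1) - muFn (m + l + 2) U S0 (t + 1) k) -
        ((m + l).choose t : ℝ) * D| := by
        rw [hT, ← mul_sub, abs_mul, abs_of_nonneg hA0]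
    _ ≤ A * (C'' * ((t : ℝ) + 1) ^ (-(1 + υ)) * ((m + l).choose t : ℝ)) :=
        mul_le_mul_of_nonneg_left hmain hA0
    _ = _ := by
        push_cast
        ring
end

section
/- Let u : ℝ^d → ℝ be continuously differentiable with ‖∇u(w)‖ ≤ C_u and ∇u being C_u-Lipschitz. Define the expected utility U(X; T) = E_{I_1,…,I_T}[u(w_T)] of a dataset X, where w_T is the SGD iterate after T steps trained on X. Consider the four datasets S ∪ {z_1, z_1'}, S ∪ {z_1, z_2}, S ∪ {z_1', z_2'}, S ∪ {z_2, z_2'} (ordered as the sequences z^{(1,1)}, z^{(1,2)}, z^{(2,1)}, z^{(2,2)} of length s+2), and let w_T^{(j,k)} be the SGD iterates on these sequences with shared initialization and shared mini-batch sequence (I_1,…,I_T). Then there is a constant c' depending only on C_u such that |U(S ∪ {z_1, z_1'}; T) − U(S ∪ {z_1, z_2}; T) − U(S ∪ {z_1', z_2'}; T) + U(S ∪ {z_2, z_2'}; T)| ≤ c' · ( E_{I_1,…,I_T} ‖w_T^{(1,1)} − w_T^{(1,2)} − w_T^{(2,1)} + w_T^{(2,2)}‖ + max_{j_1,k_1,j_2,k_2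 ∈ {1,2}} E_{I_1,…,I_T} ‖w_T^{(j_1,k_1)} − w_T^{(j_2,k_2)}‖² ). -/
/-- The SGD iterate after `t` steps on the data sequence `z`, with loss `L`,
mini-batch size `m`, step sizes `α`, initial point `w0`, and mini-batch index
sets `I 1, …, I t` (given as `I : Fin t → Finset (Fin N)`). -/
noncomputable def sgd {Z : Type} {d N : ℕ}
    (L : EuclideanSpace ℝ (Fin d) → Z → ℝ) (z : Fin N → Z)
    (m : ℕ) (α : ℕ → ℝ) (w0 : EuclideanSpace ℝ (Fin d)) :
    (t : ℕ) → (Fin t → Finset (Fin N)) → EuclideanSpace ℝ (Fin d)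
  | 0, _ => w0
  | t + 1, I =>
      let w := sgd L z m α w0 t fun i => I i.castSucc
      w - (α (t + 1) / (m : ℝ)) • ∑ i ∈ I (Fin.last t), gradient (fun v => L v (z i)) w

/-- Uniform average of `g` over all sequences of `t` mini-batch index sets,
each a size-`m` subset of `Fin N`. -/
noncomputable def expectBatch {N : ℕ} (t m : ℕ)
    (g : (Fin t → Finset (Fin N)) → ℝ) : ℝ :=
  (∑ I ∈ Finset.univ.filter
      (fun I : Fin t → Finset (Fin N) => ∀ τ, (I τ).card = m), g I) /
    ((Finset.univ.filter
      (fun I : Fin t → Finset (Fin N) => ∀ τ, (I τ).card = m)).card : ℝ)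

/-- The data sequence of length `s+2` consisting of the base dataset `zS`
followed by the two points `p` and `q`. -/
def seq4 {Z : Type} {s : ℕ} (zS : Fin s → Z) (p q : Z) : Fin (s + 2) → Z :=
  fun i => if h : (i : ℕ) < s then zS ⟨i, h⟩ else if (i : ℕ) = s then p else q

/-- The expected utility `U(z; T) = E_{I_1,…,I_T}[u(w_T)]` of the data sequence `z`. -/
noncomputable def expUtility {Z : Type} {d N : ℕ}
    (L : EuclideanSpace ℝ (Fin d) → Z → ℝ) (u : EuclideanSpace ℝ (Fin d) → ℝ)
    (m : ℕ) (α : ℕ → ℝ) (w0 : EuclideanSpace ℝ (Fin d)) (T : ℕ)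
    (z : Fin N → Z) : ℝ :=
  expectBatch T m fun I => u (sgd L z m α w0 T I)

theorem abs_sub_sub_inner_gradient_le {F : Type*} [NormedAddCommGroup F] [InnerProductSpace ℝ F]
    [CompleteSpace F] {u : F → ℝ} {K : ℝ} (hK : 0 ≤ K) (hu : Differentiable ℝ u)
    (hlip : ∀ w w', ‖gradient u w' - gradient u w‖ ≤ K * ‖w' - w‖) (x y : F) :
    |u y - u x - inner ℝ (gradient u x) (y - x)| ≤ K * ‖y - x‖ ^ 2 := by
  have h := (convex_closedBall x ‖y - x‖).norm_image_sub_le_of_norm_hasFDerivWithin_le'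
    (f := u) (f' := fun w => InnerProductSpace.toDual ℝ F (gradient u w))
    (φ := InnerProductSpace.toDual ℝ F (gradient u x)) (C := K * ‖y - x‖) (x := x) (y := y)
    (fun w _ => (hu w).hasGradientAt.hasFDerivAt.hasFDerivWithinAt)
    (fun w hw => by
      rw [← map_sub, LinearIsometryEquiv.norm_map]
      rw [mem_closedBall_iff_norm] at hw
      exact (hlip x w).trans (by gcongr))
    (by simp) (mem_closedBall_iff_norm.2 le_rfl)
  simpa [Real.norm_eq_abs, InnerProductSpace.toDual_apply_apply, pow_two, mul_assoc] using h

theorem abs_second_difference_le {F : Type*} [NormedAddCommGroup F] [InnerProductSpace ℝ F]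
    [CompleteSpace F] {u : F → ℝ} {K : ℝ} (hK : 0 ≤ K) (hu : Differentiable ℝ u)
    (hbd : ∀ w, ‖gradient u w‖ ≤ K)
    (hlip : ∀ w w', ‖gradient u w' - gradient u w‖ ≤ K * ‖w' - w‖) (a b c e : F) :
    |u a - u b - u c + u e| ≤
      K * ‖a - b - c + e‖ + K * (‖b - a‖ ^ 2 + ‖c - a‖ ^ 2 + ‖e - a‖ ^ 2) := by
  have hb := abs_le.1 (abs_sub_sub_inner_gradient_le hK hu hlip a b)
  have hc := abs_le.1 (abs_sub_sub_inner_gradient_le hK hu hlip a c)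
  have he := abs_le.1 (abs_sub_sub_inner_gradient_le hK hu hlip a e)
  have hi : |inner ℝ (gradient u a) (a - b - c + e)| ≤ K * ‖a - b - c + e‖ :=
    (abs_real_inner_le_norm _ _).trans (by gcongr; exact hbd a)
  have hi := abs_le.1 hi
  simp only [inner_sub_right, inner_add_right] at hb hc he hi
  rw [abs_le]
  constructor <;> linarith [hb.1, hb.2, hc.1, hc.2, he.1, he.2, hi.1, hi.2]

theorem expectBatch_mono {N t m : ℕ} {f g : (Fin t → Finset (Fin N)) → ℝ} (h : ∀ I, f I ≤ g I) :
    expectBatch t m f ≤ expectBatch t m g :=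
  div_le_div_of_nonneg_right (Finset.sum_le_sum fun I _ => h I) (Nat.cast_nonneg _)

theorem expectBatch_nonneg {N t m : ℕ} {f : (Fin t → Finset (Fin N)) → ℝ} (h : ∀ I, 0 ≤ f I) :
    0 ≤ expectBatch t m f :=
  div_nonneg (Finset.sum_nonneg fun I _ => h I) (Nat.cast_nonneg _)

theorem expectBatch_add {N t m : ℕ} (f g : (Fin t → Finset (Fin N)) → ℝ) :
    expectBatch t m (fun I => f I + g I) = expectBatch t m f + expectBatch t m g := by
  simp only [expectBatch, Finset.sum_add_distrib, add_div]

theorem expectBatch_sub {N t m : ℕ} (f g : (Fin t → Finset (Fin N)) → ℝ) :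
    expectBatch t m (fun I => f I - g I) = expectBatch t m f - expectBatch t m g := by
  simp only [expectBatch, Finset.sum_sub_distrib, sub_div]

theorem expectBatch_const_mul {N t m : ℕ} (k : ℝ) (f : (Fin t → Finset (Fin N)) → ℝ) :
    expectBatch t m (fun I => k * f I) = k * expectBatch t m f := by
  simp only [expectBatch, ← Finset.mul_sum, mul_div_assoc]

theorem abs_expectBatch_le {N t m : ℕ} (f : (Fin t → Finset (Fin N)) → ℝ) :
    |expectBatch t m f| ≤ expectBatch t m fun I => |f I| := by
  unfold expectBatch
  rw [abs_div, Nat.abs_cast]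
  exact div_le_div_of_nonneg_right (Finset.abs_sum_le_sum_abs _ _) (Nat.cast_nonneg _)

/-- The second-order difference of expected utilities is controlled (up to a
constant depending only on `C_u`) by the expected second-order iterate difference
plus the maximal expected squared pairwise iterate distance. -/
theorem utility_second_order_via_iterates (Cu : ℝ) (hCu : 0 < Cu) :
    ∃ c' : ℝ, ∀ (d : ℕ) (Z : Type) (L : EuclideanSpace ℝ (Fin d) → Z → ℝ)
      (u : EuclideanSpace ℝ (Fin d) → ℝ),
      ContDiff ℝ 1 u →
      (∀ w, ‖gradient u w‖ ≤ Cu) →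
      (∀ w w' : EuclideanSpace ℝ (Fin d), ‖gradient u w' - gradient u w‖ ≤ Cu * ‖w' - w‖) →
      (∀ z : Z, Differentiable ℝ fun w => L w z) →
      ∀ (s : ℕ) (zS : Fin s → Z) (z1 z1' z2 z2' : Z)
        (m T : ℕ) (α : ℕ → ℝ) (w0 : EuclideanSpace ℝ (Fin d)),
        |expUtility L u m α w0 T (seq4 zS z1 z1') -
            expUtility L u m α w0 T (seq4 zS z1 z2) -
            expUtility L u m α w0 T (seq4 zS z2' z1') +
            expUtility L u m α w0 T (seq4 zS z2' z2)| ≤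
          c' * (expectBatch T m (fun I =>
              ‖sgd L (seq4 zS z1 z1') m α w0 T I - sgd L (seq4 zS z1 z2) m α w0 T I -
                  sgd L (seq4 zS z2' z1') m α w0 T I + sgd L (seq4 zS z2' z2) m α w0 T I‖) +
            (Finset.univ : Finset ((Fin 2 × Fin 2) × (Fin 2 × Fin 2))).sup'
              Finset.univ_nonempty
              (fun p => expectBatch T m fun I =>
                ‖sgd L (seq4 zS (![z1, z2'] p.1.1) (![z1', z2] p.1.2)) m α w0 T I -
                    sgd L (seq4 zS (![z1, z2'] p.2.1) (![z1', z2] p.2.2)) m α w0 T I‖ ^ 2)) := by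
  refine ⟨3 * Cu, fun d Z L u hu hbd hlip _ s zS z1 z1' z2 z2' m T α w0 => ?_⟩
  set D : Fin 2 × Fin 2 → Fin 2 × Fin 2 → ℝ := fun p q => expectBatch T m fun I =>
    ‖sgd L (seq4 zS (![z1, z2'] p.1) (![z1', z2] p.2)) m α w0 T I -
      sgd L (seq4 zS (![z1, z2'] q.1) (![z1', z2] q.2)) m α w0 T I‖ ^ 2 with hD
  set M := (Finset.univ : Finset ((Fin 2 × Fin 2) × (Fin 2 × Fin 2))).sup'
    Finset.univ_nonempty (fun p => D p.1 p.2)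
  have hM : ∀ p q, D p q ≤ M := fun p q =>
    Finset.le_sup' (fun p : (Fin 2 × Fin 2) × (Fin 2 × Fin 2) => D p.1 p.2)
      (Finset.mem_univ (p, q))
  have hb := hM (0, 1) (0, 0)
  have hc := hM (1, 0) (0, 0)
  have he := hM (1, 1) (0, 0)
  simp only [hD, Matrix.cons_val_zero, Matrix.cons_val_one] at hb hc he
  set a := sgd L (seq4 zS z1 z1') m α w0 T
  set b := sgd L (seq4 zS z1 z2) m α w0 T
  set c := sgd L (seq4 zS z2' z1') m α w0 T
  set e := sgd L (seq4 zS z2' z2) m α w0 T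
  have hΔ : 0 ≤ expectBatch T m fun I => ‖a I - b I - c I + e I‖ :=
    expectBatch_nonneg fun I => norm_nonneg _
  calc _ = |expectBatch T m fun I => u (a I) - u (b I) - u (c I) + u (e I)| := by
        simp only [expUtility, expectBatch_add, expectBatch_sub, a, b, c, e]
    _ ≤ expectBatch T m fun I => Cu * ‖a I - b I - c I + e I‖ +
          Cu * (‖b I - a I‖ ^ 2 + ‖c I - a I‖ ^ 2 + ‖e I - a I‖ ^ 2) :=
        (abs_expectBatch_le _).trans <| expectBatch_mono fun I =>
          abs_second_difference_le hCu.le (hu.differentiable one_ne_zero) hbd hlip _ _ _ _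
    _ = Cu * (expectBatch T m fun I => ‖a I - b I - c I + e I‖) +
          Cu * ((expectBatch T m fun I => ‖b I - a I‖ ^ 2) +
            (expectBatch T m fun I => ‖c I - a I‖ ^ 2) +
            expectBatch T m fun I => ‖e I - a I‖ ^ 2) := by
        simp only [expectBatch_add, expectBatch_const_mul]
    _ ≤ 3 * Cu * ((expectBatch T m fun I => ‖a I - b I - c I + e I‖) + M) := by
        nlinarith [mul_nonneg hCu.le hΔ, mul_le_mul_of_nonneg_left hb hCu.le,
          mul_le_mul_of_nonneg_left hc hCu.le, mul_le_mul_of_nonneg_left he hCu.le]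
end

section
/- Suppose u : ℝ^d → ℝ is continuously differentiable with bounded, L-Lipschitz gradient, the loss ℓ(θ; z) is convex in θ, three times continuously differentiable in θ with all derivatives in θ up to order three uniformly bounded over θ and z, and λ > 0. For any finite dataset X, let θ̂_X be the unique minimizer of (1/|X|)·Σ_{z ∈ X} ℓ(θ; z) + (λ/2)‖θ‖², and define the utility U(X) = u(θ̂_X). Then there is a constant C (depending only on λ, L, and the bounds, not on s or the points) such that for every dataset S of size s ≥ 1 and all points z_1, z_1', z_2, z_2': |U(S ∪ {z_1, z_1'}) − U(S ∪ {z_1, z_2}) − U(S ∪ {z_1', z_2'}) + U(S ∪ {z_2, z_2'})| ≤ C·s^{−2}. -/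
open scoped Gradient InnerProductSpace

/-- A function with Lipschitz derivative has second differences controlled by the product of
the two increments. -/
theorem norm_second_difference_le {E F : Type*} [NormedAddCommGroup E] [NormedSpace ℝ E]
    [NormedAddCommGroup F] [NormedSpace ℝ F] {f : E → F} {K : ℝ}
    (hf : Differentiable ℝ f)
    (hK : ∀ x y, ‖fderiv ℝ f y - fderiv ℝ f x‖ ≤ K * ‖y - x‖) (x h k : E) :
    ‖f x - f (x + h) - f (x + k) + f (x + h + k)‖ ≤ K * ‖h‖ * ‖k‖ := by
  have hd : ∀ y, HasFDerivAt (fun y => f (y + k) - f y)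
      (fderiv ℝ f (y + k) - fderiv ℝ f y) y := fun y =>
    ((hasFDerivAt_comp_add_right k).2 (hf (y + k)).hasFDerivAt).sub (hf y).hasFDerivAt
  have hmv := convex_univ.norm_image_sub_le_of_norm_hasFDerivWithin_le
    (C := K * ‖k‖) (fun y _ => (hd y).hasFDerivWithinAt)
    (fun y _ => by simpa using hK y (y + k)) (Set.mem_univ x) (Set.mem_univ (x + h))
  calc ‖f x - f (x + h) - f (x + k) + f (x + h + k)‖
      = ‖f (x + h + k) - f (x + h) - (f (x + k) - f x)‖ := by congr 1; abel
    _ ≤ K * ‖k‖ * ‖x + h - x‖ := hmv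
    _ = K * ‖h‖ * ‖k‖ := by rw [add_sub_cancel_left]; ring

theorem norm_sub_le_of_norm_fderiv_le {E F : Type*} [NormedAddCommGroup E] [NormedSpace ℝ E]
    [NormedAddCommGroup F] [NormedSpace ℝ F] {f : E → F} {B : ℝ}
    (hf : Differentiable ℝ f) (hB : ∀ x, ‖fderiv ℝ f x‖ ≤ B) (x y : E) :
    ‖f y - f x‖ ≤ B * ‖y - x‖ :=
  convex_univ.norm_image_sub_le_of_norm_fderiv_le (fun z _ => hf z) (fun z _ => hB z)
    (Set.mem_univ x) (Set.mem_univ y)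

/-- The first-order inequality for differentiable convex functions. -/
theorem ConvexOn.fderiv_sub_le {E : Type*} [NormedAddCommGroup E] [NormedSpace ℝ E]
    {f : E → ℝ} (hc : ConvexOn ℝ Set.univ f) (hf : Differentiable ℝ f) (x y : E) :
    fderiv ℝ f x (y - x) ≤ f y - f x := by
  have hφ : ConvexOn ℝ Set.univ (f ∘ AffineMap.lineMap (k := ℝ) x y) :=
    hc.comp_affineMap (AffineMap.lineMap (k := ℝ) x y)
  have hd : HasDerivAt (f ∘ AffineMap.lineMap (k := ℝ) x y) (fderiv ℝ f x (y - x)) 0 := by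
    apply HasFDerivAt.comp_hasDerivAt
    · rw [AffineMap.lineMap_apply_zero]
      exact (hf x).hasFDerivAt
    · exact AffineMap.hasDerivAt_lineMap
  simpa [slope_def_field] using
    hφ.le_slope_of_hasDerivAt (Set.mem_univ 0) (Set.mem_univ 1) one_pos hd

/-- The gradient of a differentiable convex function is monotone. -/
theorem ConvexOn.inner_gradient_sub_nonneg {E : Type*} [NormedAddCommGroup E]
    [InnerProductSpace ℝ E] [CompleteSpace E] {f : E → ℝ} (hc : ConvexOn ℝ Set.univ f)
    (hf : Differentiable ℝ f) (x y : E) : 0 ≤ ⟪∇ f x - ∇ f y, x - y⟫_ℝ := by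
  have h₁ := hc.fderiv_sub_le hf x y
  have h₂ := hc.fderiv_sub_le hf y x
  rw [inner_sub_left, inner_gradient_left, inner_gradient_left]
  rw [← neg_sub x y, map_neg] at h₁
  linarith

theorem ContDiff.gradient {E : Type*} [NormedAddCommGroup E] [InnerProductSpace ℝ E]
    [CompleteSpace E] {f : E → ℝ} {n m : WithTop ℕ∞} (hf : ContDiff ℝ n f) (hmn : m + 1 ≤ n) :
    ContDiff ℝ m (∇ f) :=
  (InnerProductSpace.toDual ℝ E).symm.contDiff.comp (hf.fderiv_right hmn)

theorem norm_fderiv_sub_fderiv_eq {E : Type*} [NormedAddCommGroup E] [InnerProductSpace ℝ E]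
    [CompleteSpace E] (f : E → ℝ) (x y : E) :
    ‖fderiv ℝ f y - fderiv ℝ f x‖ = ‖∇ f y - ∇ f x‖ := by
  rw [← toDual_gradient, ← toDual_gradient, ← map_sub, LinearIsometryEquiv.norm_map]

/-- A strongly monotone map is expanding. -/
theorem mul_norm_sub_le_of_strongly_monotone {E : Type*} [NormedAddCommGroup E]
    [InnerProductSpace ℝ E] {c : ℝ} {x y v : E} (h : c * ‖x - y‖ ^ 2 ≤ ⟪v, x - y⟫_ℝ) :
    c * ‖x - y‖ ≤ ‖v‖ := by
  rcases (norm_nonneg (x - y)).eq_or_lt with h₀ | h₀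
  · simp [← h₀]
  · refine le_of_mul_le_mul_right ?_ h₀
    calc c * ‖x - y‖ * ‖x - y‖ = c * ‖x - y‖ ^ 2 := by ring
      _ ≤ ‖v‖ * ‖x - y‖ := h.trans (real_inner_le_norm _ _)

/-- Two solutions of the perturbed equation `H θ + g p θ + g q θ = 0` are close. -/
theorem norm_sub_le_of_stationary {E Z : Type*} [NormedAddCommGroup E]
    {H : E → E} {g : Z → E → E} {c B : ℝ} (hc : 0 < c)
    (hH : ∀ x y, c * ‖x - y‖ ≤ ‖H x - H y‖) (hg : ∀ z x, ‖g z x‖ ≤ B)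
    {p q p' q' : Z} {x y : E} (hx : H x + g p x + g q x = 0)
    (hy : H y + g p' y + g q' y = 0) : ‖x - y‖ ≤ 4 * B / c := by
  rw [le_div_iff₀' hc]
  refine (hH x y).trans ?_
  have hxy : H x - H y = g p' y + g q' y - (g p x + g q x) := by
    rw [eq_neg_of_add_eq_zero_left (a := H x) (b := g p x + g q x) (by rw [← hx]; abel),
      eq_neg_of_add_eq_zero_left (a := H y) (b := g p' y + g q' y) (by rw [← hy]; abel)]
    abel
  rw [hxy]
  have h₁ := norm_sub_le (g p' y + g q' y) (g p x + g q x)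
  have h₂ := norm_add_le (g p' y) (g q' y)
  have h₃ := norm_add_le (g p x) (g q x)
  linarith [hg p' y, hg q' y, hg p x, hg q x]

/-- The second difference of solutions of the perturbed equation `H θ + g p θ + g q θ = 0`
is of second order in `1 / c`. -/
theorem norm_second_difference_stationary_le {E Z : Type*} [NormedAddCommGroup E]
    {H : E → E} {g : Z → E → E} {c B K : ℝ} (hc : 0 < c) (hB : 0 ≤ B) (hK : 0 ≤ K)
    (hH : ∀ x y, c * ‖x - y‖ ≤ ‖H x - H y‖)
    (hH₂ : ∀ x h k, ‖H x - H (x + h) - H (x + k) + H (x + h + k)‖ ≤ K * ‖h‖ * ‖k‖)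
    (hg : ∀ z x, ‖g z x‖ ≤ B) (hg₁ : ∀ z x y, ‖g z y - g z x‖ ≤ B * ‖y - x‖)
    {θ : Z → Z → E} (hθ : ∀ p q, H (θ p q) + g p (θ p q) + g q (θ p q) = 0)
    (a a' b b' : Z) :
    c * ‖θ a a' - (θ b b' + (θ a b - θ b b') + (θ a' b' - θ b b'))‖ ≤
      16 * B ^ 2 / c + K * (4 * B / c) ^ 2 := by
  have hclose : ∀ p q p' q', ‖θ p q - θ p' q'‖ ≤ 4 * B / c := fun p q p' q' =>
    norm_sub_le_of_stationary hc hH hg (hθ p q) (hθ p' q')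
  have hsol : ∀ p q, H (θ p q) = -(g p (θ p q) + g q (θ p q)) := fun p q =>
    eq_neg_of_add_eq_zero_left (by rw [← hθ p q]; abel)
  have hgθ : ∀ z p q p' q', ‖g z (θ p q) - g z (θ p' q')‖ ≤ B * (4 * B / c) :=
    fun z p q p' q' => (hg₁ z _ _).trans (mul_le_mul_of_nonneg_left (hclose p q p' q') hB)
  refine (hH _ _).trans ?_
  set w := θ b b' + (θ a b - θ b b') + (θ a' b' - θ b b') with hw
  have hE := hH₂ (θ b b') (θ a b - θ b b') (θ a' b' - θ b b')
  rw [← hw, add_sub_cancel, add_sub_cancel] at hE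
  have hE' : ‖H (θ b b') - H (θ a b) - H (θ a' b') + H w‖ ≤ K * (4 * B / c) ^ 2 := by
    refine hE.trans ?_
    rw [mul_assoc, sq]
    gcongr
    · exact hclose a b b b'
    · exact hclose a' b' b b'
  have hD : ‖H (θ a a') - H (θ a b) - H (θ a' b') + H (θ b b')‖ ≤ 16 * B ^ 2 / c := by
    have e : H (θ a a') - H (θ a b) - H (θ a' b') + H (θ b b') =
        (g a (θ a b) - g a (θ a a')) + (g a' (θ a' b') - g a' (θ a a')) +
        (g b (θ a b) - g b (θ b b')) + (g b' (θ a' b') - g b' (θ b b')) := by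
      simp only [hsol]; abel
    rw [e]
    refine (norm_add₄_le ..).trans ?_
    have e' : 16 * B ^ 2 / c = 4 * (B * (4 * B / c)) := by ring
    linarith [hgθ a a b a a', hgθ a' a' b' a a', hgθ b a b b b', hgθ b' a' b' b b']
  calc ‖H (θ a a') - H w‖
      = ‖(H (θ a a') - H (θ a b) - H (θ a' b') + H (θ b b')) -
          (H (θ b b') - H (θ a b) - H (θ a' b') + H w)‖ := by congr 1; abel
    _ ≤ _ := (norm_sub_le _ _).trans (add_le_add hD hE')

/-- A minimizer of the regularized empirical risk is a stationary point. -/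
theorem gradient_sum_add_smul_eq_zero_of_isMinOn {E ι : Type*} [Fintype ι]
    [NormedAddCommGroup E] [InnerProductSpace ℝ E] [CompleteSpace E]
    {f : ι → E → ℝ} {fp fq : E → ℝ} {m lam : ℝ} (hm : 0 < m)
    (hf : ∀ i, Differentiable ℝ (f i)) (hp : Differentiable ℝ fp) (hq : Differentiable ℝ fq)
    {x : E} (hx : IsMinOn (fun θ => 1 / m * ((∑ i, f i θ) + fp θ + fq θ) +
      lam / 2 * ‖θ‖ ^ 2) Set.univ x) :
    (∑ i, ∇ (f i) x + (m * lam) • x) + ∇ fp x + ∇ fq x = 0 := by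
  have hd : HasFDerivAt (fun θ => 1 / m * ((∑ i, f i θ) + fp θ + fq θ) + lam / 2 * ‖θ‖ ^ 2)
      ((1 / m) • ((∑ i, fderiv ℝ (f i) x) + fderiv ℝ fp x + fderiv ℝ fq x) +
        (lam / 2) • (2 • innerSL ℝ x)) x :=
    ((((HasFDerivAt.fun_sum fun i _ => (hf i x).hasFDerivAt).add (hp x).hasFDerivAt).add
      (hq x).hasFDerivAt).const_mul (1 / m)).add
      ((hasStrictFDerivAt_norm_sq x).hasFDerivAt.const_mul (lam / 2))
  have h₀ := (hx.isLocalMin Filter.univ_mem).fderiv_eq_zero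
  rw [hd.fderiv] at h₀
  refine ext_inner_right ℝ fun v => ?_
  have hv := DFunLike.congr_fun h₀ v
  simp only [add_apply, smul_apply,
    sum_apply, innerSL_apply_apply, zero_apply,
    smul_eq_mul, nsmul_eq_mul] at hv
  simp only [inner_add_left, sum_inner, inner_gradient_left, real_inner_smul_left,
    inner_zero_left]
  field_simp at hv
  push_cast at hv
  linarith


/-- Second-order algorithmic stability of the influence-function utility:
for the utility `U(X) = u(θ̂_X)` where `θ̂_X` minimizes the regularized empirical
risk over `X`, the second-order utility difference over the four datasets
`S ∪ {z1, z1'}, S ∪ {z1, z2}, S ∪ {z1', z2'}, S ∪ {z2, z2'}` is `O(s^{−2})`. -/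
theorem influence_function_utility_stability {d : ℕ} {Z : Type}
    (L : EuclideanSpace ℝ (Fin d) → Z → ℝ) (u : EuclideanSpace ℝ (Fin d) → ℝ)
    (lam B Lu : ℝ) (hlam : 0 < lam) (hB : 0 < B) (hLu : 0 < Lu)
    (hu1 : ContDiff ℝ 1 u)
    (hu2 : ∀ θ, ‖gradient u θ‖ ≤ B)
    (hu3 : ∀ θ θ' : EuclideanSpace ℝ (Fin d),
      ‖gradient u θ' - gradient u θ‖ ≤ Lu * ‖θ' - θ‖)
    (hconv : ∀ z : Z, ConvexOn ℝ Set.univ fun θ => L θ z)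
    (hC3 : ∀ z : Z, ContDiff ℝ 3 fun θ => L θ z)
    (hd1 : ∀ (θ : EuclideanSpace ℝ (Fin d)) (z : Z),
      ‖gradient (fun θ' => L θ' z) θ‖ ≤ B)
    (hd2 : ∀ (θ : EuclideanSpace ℝ (Fin d)) (z : Z),
      ‖fderiv ℝ (gradient fun θ' => L θ' z) θ‖ ≤ B)
    (hd3 : ∀ (θ : EuclideanSpace ℝ (Fin d)) (z : Z),
      ‖fderiv ℝ (fderiv ℝ (gradient fun θ' => L θ' z)) θ‖ ≤ B) :
    ∃ C : ℝ, ∀ s : ℕ, 1 ≤ s → ∀ (zS : Fin s → Z) (z1 z1' z2 z2' : Z)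
      (θhat : Z → Z → EuclideanSpace ℝ (Fin d)),
      (∀ p q : Z,
        IsMinOn (fun θ => 1 / ((s : ℝ) + 2) * ((∑ i, L θ (zS i)) + L θ p + L θ q) +
          lam / 2 * ‖θ‖ ^ 2) Set.univ (θhat p q)) →
      |u (θhat z1 z1') - u (θhat z1 z2) - u (θhat z1' z2') + u (θhat z2 z2')| ≤
        C / (s : ℝ) ^ 2 := by
  have hdL : ∀ z, Differentiable ℝ fun θ => L θ z := fun z => (hC3 z).differentiable (by norm_num)
  have hG : ∀ z, ContDiff ℝ 2 (∇ fun θ => L θ z) := fun z => (hC3 z).gradient (by norm_num)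
  have hdG : ∀ z, Differentiable ℝ (∇ fun θ => L θ z) := fun z =>
    (hG z).differentiable (by norm_num)
  have hdG' : ∀ z, Differentiable ℝ (fderiv ℝ (∇ fun θ => L θ z)) := fun z =>
    ((hG z).fderiv_right (m := 1) (by norm_num)).differentiable (by norm_num)
  have hdu : Differentiable ℝ u := hu1.differentiable (by norm_num)
  refine ⟨B * (16 * B ^ 2 / lam ^ 2 + 16 * B ^ 3 / lam ^ 3) + Lu * (4 * B / lam) ^ 2,
    fun s hs zS z1 z1' z2 z2' θ hθ => ?_⟩
  have hs₀ : (0 : ℝ) < s := by exact_mod_cast hs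
  set m : ℝ := (s : ℝ) + 2 with hmdef
  have hm : 0 < m := by positivity
  have hc : 0 < m * lam := by positivity
  let g : Z → EuclideanSpace ℝ (Fin d) → EuclideanSpace ℝ (Fin d) := fun z => ∇ fun θ => L θ z
  let H : EuclideanSpace ℝ (Fin d) → EuclideanSpace ℝ (Fin d) := fun x =>
    ∑ i, g (zS i) x + (m * lam) • x
  have hg₁ : ∀ z x y, ‖g z y - g z x‖ ≤ B * ‖y - x‖ := fun z =>
    norm_sub_le_of_norm_fderiv_le (hdG z) fun x => hd2 x z
  have hH : ∀ x y, m * lam * ‖x - y‖ ≤ ‖H x - H y‖ := by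
    intro x y
    apply mul_norm_sub_le_of_strongly_monotone
    have e : H x - H y = ∑ i, (g (zS i) x - g (zS i) y) + (m * lam) • (x - y) := by
      simp only [H, Finset.sum_sub_distrib, smul_sub]; abel
    rw [e, inner_add_left, sum_inner, real_inner_smul_left, real_inner_self_eq_norm_sq]
    exact le_add_of_nonneg_left (Finset.sum_nonneg fun i _ =>
      (hconv (zS i)).inner_gradient_sub_nonneg (hdL (zS i)) x y)
  have hH₂ : ∀ x h k, ‖H x - H (x + h) - H (x + k) + H (x + h + k)‖ ≤
      (m * B) * ‖h‖ * ‖k‖ := by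
    intro x h k
    have e : H x - H (x + h) - H (x + k) + H (x + h + k) =
        ∑ i, (g (zS i) x - g (zS i) (x + h) - g (zS i) (x + k) + g (zS i) (x + h + k)) := by
      simp only [H, Finset.sum_sub_distrib, Finset.sum_add_distrib, smul_add]; abel
    rw [e]
    refine (norm_sum_le_of_le (n := fun _ => B * ‖h‖ * ‖k‖) _ fun i _ =>
      norm_second_difference_le (hdG (zS i)) (norm_sub_le_of_norm_fderiv_le (hdG' (zS i))
        fun x => hd3 x (zS i)) x h k).trans ?_
    rw [Finset.sum_const, Finset.card_univ, Fintype.card_fin, nsmul_eq_mul, mul_assoc m B,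
      mul_assoc m]
    gcongr
    exact le_add_of_nonneg_right zero_le_two
  have hsol : ∀ p q, H (θ p q) + g p (θ p q) + g q (θ p q) = 0 := fun p q =>
    gradient_sum_add_smul_eq_zero_of_isMinOn hm (fun i => hdL (zS i)) (hdL p) (hdL q) (hθ p q)
  have hclose : ∀ p q p' q', ‖θ p q - θ p' q'‖ ≤ 4 * B / (m * lam) := fun p q p' q' =>
    norm_sub_le_of_stationary hc hH (fun z x => hd1 x z) (hsol p q) (hsol p' q')
  have hsec := norm_second_difference_stationary_le hc hB.le (by positivity) hH hH₂
    (fun z x => hd1 x z) hg₁ hsol z1 z1' z2 z2'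
  have hu₂ := norm_second_difference_le hdu (fun x y => (norm_fderiv_sub_fderiv_eq u x y).trans_le
    (hu3 x y)) (θ z2 z2') (θ z1 z2 - θ z2 z2') (θ z1' z2' - θ z2 z2')
  rw [add_sub_cancel, add_sub_cancel] at hu₂
  rw [add_sub_cancel] at hsec
  set w := θ z1 z2 + (θ z1' z2' - θ z2 z2')
  have hu₁ : ‖u (θ z1 z1') - u w‖ ≤ B * ‖θ z1 z1' - w‖ :=
    norm_sub_le_of_norm_fderiv_le hdu
      (fun x => by rw [← toDual_gradient, LinearIsometryEquiv.norm_map]; exact hu2 x) _ _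
  have hdist : ‖θ z1 z1' - w‖ ≤ (16 * B ^ 2 / lam ^ 2 + 16 * B ^ 3 / lam ^ 3) / m ^ 2 := by
    refine le_of_mul_le_mul_left (hsec.trans_eq ?_) hc
    field_simp
    ring
  have hu₂' : ‖u (θ z2 z2') - u (θ z1 z2) - u (θ z1' z2') + u w‖ ≤
      Lu * (4 * B / lam) ^ 2 / m ^ 2 := by
    calc _ ≤ Lu * ‖θ z1 z2 - θ z2 z2'‖ * ‖θ z1' z2' - θ z2 z2'‖ := hu₂
      _ ≤ Lu * (4 * B / (m * lam)) * (4 * B / (m * lam)) := by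
        gcongr
        · exact hclose z1 z2 z2 z2'
        · exact hclose z1' z2' z2 z2'
      _ = _ := by field_simp
  calc |u (θ z1 z1') - u (θ z1 z2) - u (θ z1' z2') + u (θ z2 z2')|
      = ‖(u (θ z1 z1') - u w) + (u (θ z2 z2') - u (θ z1 z2) - u (θ z1' z2') + u w)‖ := by
        rw [Real.norm_eq_abs]; congr 1; ring
    _ ≤ B * ((16 * B ^ 2 / lam ^ 2 + 16 * B ^ 3 / lam ^ 3) / m ^ 2) +
        Lu * (4 * B / lam) ^ 2 / m ^ 2 :=
      (norm_add_le _ _).trans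
        (add_le_add (hu₁.trans (mul_le_mul_of_nonneg_left hdist hB.le)) hu₂')
    _ = (B * (16 * B ^ 2 / lam ^ 2 + 16 * B ^ 3 / lam ^ 3) + Lu * (4 * B / lam) ^ 2) / m ^ 2 := by
      ring
    _ ≤ _ := by
      gcongr
      linarith
end
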